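/- arXiv:0907.3912 — 3 statements merged into one kernel-verified Lean document; each statement's English description precedes it below -/
import Mathlib

section
/- Let k be an infinite field with char k ≠ 2, and let A be a standard graded artinian level k-algebra with Hilbert function (h_0, h_1, …, h_d). If for some positive integer m one has h_d = C(m+d, d) and h_{d−1} = C(m+d−1, d−1) + 1, then A has the weak Lefschetz property. -/
open MvPolynomial

/-- The degree-`d` graded component of `R/I` (the image of the space of
degree-`d` homogeneous polynomials in the quotient), as a `k`-submodule. -/
noncomputable def gradedPiece (k : Type*) [Field k] (r : ℕ)
    (I : Ideal (MvPolynomial (Fin r) k)) (d : ℕ) :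
    Submodule k (MvPolynomial (Fin r) k ⧸ I) :=
  Submodule.map (Ideal.Quotient.mkₐ k I).toLinearMap
    (homogeneousSubmodule (Fin r) k d)

/-- The Hilbert function of `R/I` in degree `d`. -/
noncomputable def hilb (k : Type*) [Field k] (r : ℕ)
    (I : Ideal (MvPolynomial (Fin r) k)) (d : ℕ) : ℕ :=
  Module.finrank k (gradedPiece k r I d)

/-- `I` is a homogeneous ideal. -/
def IsHomogIdeal {k : Type*} [Field k] {r : ℕ}
    (I : Ideal (MvPolynomial (Fin r) k)) : Prop :=
  ∀ f ∈ I, ∀ n : ℕ, homogeneousComponent n f ∈ I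

/-- `I` contains no nonzero linear forms. -/
def NoLinearForms {k : Type*} [Field k] {r : ℕ}
    (I : Ideal (MvPolynomial (Fin r) k)) : Prop :=
  ∀ f ∈ I, f.IsHomogeneous 1 → f = 0

/-- The dimension of the degree-`i` component of the socle of `R/I`. -/
noncomputable def socDim (k : Type*) [Field k] (r : ℕ)
    (I : Ideal (MvPolynomial (Fin r) k)) (i : ℕ) : ℕ :=
  Module.finrank k (Submodule.map (Ideal.Quotient.mkₐ k I).toLinearMap
    (homogeneousSubmodule (Fin r) k i ⊓
      ⨅ j : Fin r, Submodule.comap (LinearMap.mulLeft k (X j))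
        (Submodule.restrictScalars k I)))

/-- `R/I` is a standard graded artinian algebra:
`I` is homogeneous and `R/I` is finite-dimensional over `k`. -/
def StdArtinian (k : Type*) [Field k] (r : ℕ)
    (I : Ideal (MvPolynomial (Fin r) k)) : Prop :=
  IsHomogIdeal I ∧ Module.Finite k (MvPolynomial (Fin r) k ⧸ I)

/-- `R/I` has socle degree `e`: `e` is the largest degree with nonzero
Hilbert function. -/
def SocleDegree (k : Type*) [Field k] (r : ℕ)
    (I : Ideal (MvPolynomial (Fin r) k)) (e : ℕ) : Prop :=
  hilb k r I e ≠ 0 ∧ ∀ j : ℕ, e < j → hilb k r I j = 0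

/-- `R/I` is a standard graded artinian Gorenstein algebra of socle degree `e`:
the socle vanishes below degree `e` and is one-dimensional in degree `e`. -/
def Gorenstein (k : Type*) [Field k] (r e : ℕ)
    (I : Ideal (MvPolynomial (Fin r) k)) : Prop :=
  StdArtinian k r I ∧ SocleDegree k r I e ∧
    (∀ i : ℕ, i < e → socDim k r I i = 0) ∧ socDim k r I e = 1

/-- `R/I` is a standard graded artinian level algebra of socle degree `e`. -/
def LevelAlg (k : Type*) [Field k] (r e : ℕ)
    (I : Ideal (MvPolynomial (Fin r) k)) : Prop :=
  StdArtinian k r I ∧ SocleDegree k r I e ∧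
    (∀ i : ℕ, i < e → socDim k r I i = 0)

/-- The linear form with coefficient vector `c`. -/
noncomputable def linForm {k : Type*} [Field k] {r : ℕ} (c : Fin r → k) :
    MvPolynomial (Fin r) k :=
  ∑ i, C (c i) * X i

/-- A property `P` holds for a general linear form: there is a nonempty
(basic) Zariski-open subset of the space of linear forms on which `P` holds. -/
def Generically (k : Type*) [Field k] (r : ℕ)
    (P : MvPolynomial (Fin r) k → Prop) : Prop :=
  ∃ Q : MvPolynomial (Fin r) k, Q ≠ 0 ∧
    ∀ c : Fin r → k, eval c Q ≠ 0 → P (linForm c)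

/-- `R/I` has the weak Lefschetz property (socle degree `e`): multiplication
by some linear form has maximal rank from each degree `i < e` to degree `i+1`. -/
def WLP (k : Type*) [Field k] (r e : ℕ)
    (I : Ideal (MvPolynomial (Fin r) k)) : Prop :=
  ∃ L : MvPolynomial (Fin r) k, L.IsHomogeneous 1 ∧
    ∀ i : ℕ, i < e →
      Module.finrank k (Submodule.map
        (LinearMap.mulLeft k (Ideal.Quotient.mk I L)) (gradedPiece k r I i)) =
      min (hilb k r I i) (hilb k r I (i + 1))

/-- The largest `t` with `choose t i ≤ n`: the leading top in the
`i`-binomial expansion of `n`. -/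
noncomputable def binTop (n i : ℕ) : ℕ := sSup {t : ℕ | Nat.choose t i ≤ n}

/-- Auxiliary recursion computing `((n)_{(i)})⁻¹₀`, i.e. the sum
`C(n_i - 1, i) + C(n_{i-1} - 1, i-1) + ⋯ + C(n_j - 1, j)` where
`n_{(i)} = C(n_i, i) + ⋯ + C(n_j, j)` is the `i`-binomial expansion of `n`. -/
noncomputable def greenBoundAux : ℕ → ℕ → ℕ
  | 0, _ => 0
  | (i + 1), n =>
    if n = 0 then 0 else
      Nat.choose (binTop n (i + 1) - 1) (i + 1) +
        greenBoundAux i (n - Nat.choose (binTop n (i + 1)) (i + 1))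

/-- `greenBound n i = ((n)_{(i)})⁻¹₀`. -/
noncomputable def greenBound (n i : ℕ) : ℕ := greenBoundAux i n


section GenericFilter

variable {k : Type*} [Field k]

/-- The filter on `k^r` generated by the nonempty basic Zariski-open sets. -/
def genericFilter (k : Type*) [Field k] (r : ℕ) : Filter (Fin r → k) where
  sets := {s | ∃ Q : MvPolynomial (Fin r) k, Q ≠ 0 ∧ ∀ c, eval c Q ≠ 0 → c ∈ s}
  univ_sets := ⟨1, one_ne_zero, fun _ _ => trivial⟩
  sets_of_superset := fun ⟨Q, hQ, h⟩ hst => ⟨Q, hQ, fun c hc => hst (h c hc)⟩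
  inter_sets := fun ⟨Q, hQ, h⟩ ⟨P, hP, h'⟩ => ⟨Q * P, mul_ne_zero hQ hP, fun c hc => by
    rw [map_mul] at hc
    exact ⟨h c (left_ne_zero_of_mul hc), h' c (right_ne_zero_of_mul hc)⟩⟩

instance genericFilter_neBot [Infinite k] (r : ℕ) : (genericFilter k r).NeBot := by
  refine ⟨fun h => ?_⟩
  have h0 : (∅ : Set (Fin r → k)) ∈ genericFilter k r := by rw [h]; trivial
  obtain ⟨Q, hQ, hc⟩ := h0
  exact hQ (MvPolynomial.funext fun c => by
    by_contra hne
    exact hc c (by simpa using hne))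

theorem eventually_generic_of_eval {r : ℕ} {P : (Fin r → k) → Prop}
    (Q : MvPolynomial (Fin r) k) (a : Fin r → k) (ha : eval a Q ≠ 0)
    (h : ∀ c, eval c Q ≠ 0 → P c) : ∀ᶠ c in genericFilter k r, P c :=
  ⟨Q, fun h0 => ha (by simp [h0]), h⟩

theorem eval_linForm {r : ℕ} (f : (Fin r → k) →ₗ[k] k) (c : Fin r → k) :
    eval c (∑ i, C (f (Pi.single i 1)) * X i) = f c := by
  conv_rhs => rw [pi_eq_sum_univ' c, map_sum]
  simp [mul_comm]

theorem eventually_linearIndependent {r : ℕ} {ι Y : Type*} [Fintype ι] [AddCommGroup Y]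
    [Module k Y] (ψ : ι → (Fin r → k) →ₗ[k] Y) (a : Fin r → k)
    (h : LinearIndependent k fun i => ψ i a) :
    ∀ᶠ c in genericFilter k r, LinearIndependent k fun i => ψ i c := by
  classical
  obtain ⟨g, hg⟩ := LinearMap.exists_leftInverse_of_injective
    (Fintype.linearCombination k fun i => ψ i a) (
      LinearMap.ker_eq_bot.mpr (h.fintypeLinearCombination_injective))
  have hga : ∀ i, g (ψ i a) = Pi.single i 1 := fun i => by
    have := LinearMap.congr_fun hg (Pi.single i 1)
    simpa using this
  let f : ι → ι → (Fin r → k) →ₗ[k] k := fun i j => LinearMap.proj j ∘ₗ g ∘ₗ ψ i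
  let A : Matrix ι ι (MvPolynomial (Fin r) k) :=
    Matrix.of fun i j => ∑ l, C (f i j (Pi.single l 1)) * X l
  have hA : ∀ c, eval c A.det = (Matrix.of fun i j => f i j c).det := fun c => by
    rw [RingHom.map_det]
    congr 1
    ext i j
    exact eval_linForm _ _
  refine eventually_generic_of_eval A.det a ?_ fun c hc => ?_
  · have : (Matrix.of fun i j => f i j a) = (1 : Matrix ι ι k) := by
      ext i j
      simp [f, hga, Matrix.one_apply, Pi.single_apply, eq_comm]
    rw [hA, this, Matrix.det_one]
    exact one_ne_zero
  · rw [hA] at hc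
    have : LinearIndependent k (fun i => g (ψ i c)) :=
      Matrix.linearIndependent_rows_of_det_ne_zero hc
    exact LinearIndependent.of_comp g this

theorem eventually_ne_zero {r : ℕ} {Y : Type*} [AddCommGroup Y] [Module k Y]
    (ψ : (Fin r → k) →ₗ[k] Y) (a : Fin r → k) (h : ψ a ≠ 0) :
    ∀ᶠ c in genericFilter k r, ψ c ≠ 0 := by
  filter_upwards [eventually_linearIndependent (fun _ : Unit => ψ) a
    (linearIndependent_unique_iff.mpr h)] with c hc
  exact linearIndependent_unique_iff.mp hc

theorem eventually_bilin_ne_zero {r : ℕ} {Y : Type*} [AddCommGroup Y] [Module k Y]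
    (B : (Fin r → k) →ₗ[k] (Fin r → k) →ₗ[k] Y) (a : Fin r → k) (h : B a a ≠ 0) :
    ∀ᶠ c in genericFilter k r, B c c ≠ 0 := by
  obtain ⟨y, hy⟩ : ∃ y : Module.Dual k Y, y (B a a) ≠ 0 := by
    by_contra! hn
    exact h ((Module.forall_dual_apply_eq_zero_iff k _).mp hn)
  have key : ∀ c, eval c (∑ i, X i * ∑ j, C (y (B (Pi.single i 1) (Pi.single j 1))) * X j)
      = y (B c c) := fun c => by
    have h1 : ∀ i, eval c (∑ j, C (y (B (Pi.single i 1) (Pi.single j 1))) * X j)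
        = y (B (Pi.single i 1) c) := fun i => eval_linForm (y ∘ₗ B (Pi.single i 1)) c
    have h2 : eval c (∑ i, C (y (B (Pi.single i 1) c)) * X i) = y (B c c) :=
      eval_linForm (y ∘ₗ B.flip c) c
    rw [← h2, map_sum, map_sum]
    refine Finset.sum_congr rfl fun i _ => ?_
    rw [map_mul, h1, map_mul, eval_C, eval_X, mul_comm]
  refine eventually_generic_of_eval _ a (by rw [key]; exact hy) fun c hc h0 => hc ?_
  rw [key, h0, map_zero]

theorem generic_le_submodule [Infinite k] {r : ℕ} {Y : Type*} [AddCommGroup Y] [Module k Y]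
    (ψ : (Fin r → k) →ₗ[k] Y) (H : Submodule k Y) (h : ∀ᶠ c in genericFilter k r, ψ c ∈ H)
    (a : Fin r → k) : ψ a ∈ H := by
  by_contra hn
  obtain ⟨c, h1, h2⟩ := (h.and (eventually_ne_zero (H.mkQ ∘ₗ ψ) a (by simpa using hn))).exists
  exact h2 (by simpa using h1)

end GenericFilter

section KerDim

variable {k M : Type*} [Field k] [AddCommGroup M] [Module k M] {r : ℕ}

/-- The dimension of the subspace of `W` annihilated by the operator `T a`. -/
noncomputable def kerDim (T : (Fin r → k) →ₗ[k] M →ₗ[k] M) (a : Fin r → k)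
    (W : Submodule k M) : ℕ :=
  Module.finrank k (W ⊓ LinearMap.ker (T a) : Submodule k M)

theorem finrank_map_add_kerDim (T : (Fin r → k) →ₗ[k] M →ₗ[k] M) (a : Fin r → k)
    (W : Submodule k M) [FiniteDimensional k W] :
    Module.finrank k (W.map (T a)) + kerDim T a W = Module.finrank k W := by
  rw [← LinearMap.finrank_range_add_finrank_ker ((T a).domRestrict W), LinearMap.range_domRestrict,
    LinearMap.ker_domRestrict, kerDim, ← Submodule.map_comap_subtype,
    Submodule.finrank_map_subtype_eq]

theorem exists_lift_basis_map (f : M →ₗ[k] M) (W : Submodule k M) [FiniteDimensional k W] :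
    ∃ w : Fin (Module.finrank k (W.map f)) → M, (∀ i, w i ∈ W) ∧
      LinearIndependent k (fun i => f (w i)) ∧
      Submodule.span k (Set.range fun i => f (w i)) = W.map f := by
  let b := Module.finBasis k (W.map f)
  have hb : ∀ i, ∃ w ∈ W, f w = b i := fun i => (b i).2
  choose w hw hwb using hb
  refine ⟨w, hw, ?_, ?_⟩
  · simp only [hwb]
    exact b.linearIndependent.map' (W.map f).subtype (Submodule.ker_subtype _)
  · simp only [hwb]
    have := congrArg (Submodule.map (W.map f).subtype) b.span_eq
    rwa [Submodule.map_span, ← Set.range_comp, Submodule.map_top, Submodule.range_subtype] at this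

theorem card_le_finrank_of_linearIndependent {ι : Type*} [Fintype ι] {v : ι → M}
    (W : Submodule k M) [FiniteDimensional k W] (hv : LinearIndependent k v) (h : ∀ i, v i ∈ W) :
    Fintype.card ι ≤ Module.finrank k W := by
  rw [← finrank_span_eq_card hv]
  exact Submodule.finrank_mono (Submodule.span_le.mpr (by rintro _ ⟨i, rfl⟩; exact h i))

theorem eventually_finrank_map_ge (T : (Fin r → k) →ₗ[k] M →ₗ[k] M) (a : Fin r → k)
    (W : Submodule k M) [FiniteDimensional k W] :
    ∀ᶠ c in genericFilter k r,
      Module.finrank k (W.map (T a)) ≤ Module.finrank k (W.map (T c)) := by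
  obtain ⟨w, hw, hli, -⟩ := exists_lift_basis_map (T a) W
  filter_upwards [eventually_linearIndependent (fun i => T.flip (w i)) a hli] with c hc
  simpa using card_le_finrank_of_linearIndependent (W.map (T c)) hc
    fun i => Submodule.mem_map_of_mem (hw i)

theorem eventually_kerDim_le (T : (Fin r → k) →ₗ[k] M →ₗ[k] M) (a : Fin r → k)
    (W : Submodule k M) [FiniteDimensional k W] :
    ∀ᶠ c in genericFilter k r, kerDim T c W ≤ kerDim T a W := by
  filter_upwards [eventually_finrank_map_ge T a W] with c hc
  have h1 := finrank_map_add_kerDim T a W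
  have h2 := finrank_map_add_kerDim T c W
  omega

/-- If `T a` has maximal rank on `W` among all the `T b`, then every `T n` maps the kernel of
`T a` on `W` into `T a W`. -/
theorem apply_mem_map_of_maximal_rank [Infinite k] (T : (Fin r → k) →ₗ[k] M →ₗ[k] M)
    (a : Fin r → k) (W : Submodule k M) [FiniteDimensional k W]
    (hmax : ∀ b, Module.finrank k (W.map (T b)) ≤ Module.finrank k (W.map (T a)))
    (n : Fin r → k) {v : M} (hv : v ∈ W) (hav : T a v = 0) : T n v ∈ W.map (T a) := by
  by_contra hn
  obtain ⟨w, hw, hli, hspan⟩ := exists_lift_basis_map (T a) W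
  let p : (i : Fin 2) → (Fin 2 → k) →ₗ[k] k := fun i => LinearMap.proj i
  let ψ : Option (Fin (Module.finrank k (W.map (T a)))) → (Fin 2 → k) →ₗ[k] M := fun o =>
    o.elim ((p 0).smulRight (T n v))
      fun i => (p 0).smulRight (T a (w i)) + (p 1).smulRight (T n (w i))
  have h0 : LinearIndependent k fun o => ψ o (Pi.single 0 1) := by
    rw [linearIndependent_option]
    refine ⟨?_, ?_⟩
    · simpa [ψ, p, Function.comp_def] using hli
    · simpa [ψ, p, Function.comp_def, hspan] using hn
  obtain ⟨c, hc, hc1⟩ := ((eventually_linearIndependent ψ _ h0).and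
    (eventually_ne_zero (p 1) (Pi.single 1 1) (by simp [p]))).exists
  have hc1 : c 1 ≠ 0 := hc1
  have := card_le_finrank_of_linearIndependent (W.map (T (c 0 • a + c 1 • n))) hc (by
    rintro (_ | i)
    · refine ⟨(c 0 * (c 1)⁻¹) • v, W.smul_mem _ hv, ?_⟩
      simp only [map_add, map_smul, LinearMap.add_apply, LinearMap.smul_apply, hav, smul_zero,
        zero_add, ψ, p, Option.elim, LinearMap.smulRight_apply, LinearMap.proj_apply, smul_smul]
      congr 1
      field_simp
    · refine ⟨w i, hw i, ?_⟩
      simp [ψ, p])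
  have h2 := hmax (c 0 • a + c 1 • n)
  simp at this
  omega

theorem exists_le_finrank_eq (W : Submodule k M) [FiniteDimensional k W] {n : ℕ}
    (hn : n ≤ Module.finrank k W) : ∃ W' ≤ W, Module.finrank k W' = n := by
  obtain ⟨f, hf⟩ := exists_linearIndependent_of_le_finrank hn
  refine ⟨Submodule.span k (Set.range (W.subtype ∘ f)), ?_, ?_⟩
  · rw [Submodule.span_le]
    rintro _ ⟨i, rfl⟩
    exact (f i).2
  · rw [finrank_span_eq_card (hf.map' W.subtype (Submodule.ker_subtype _)), Fintype.card_fin]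

theorem kerDim_le_add (T : (Fin r → k) →ₗ[k] M →ₗ[k] M) (a : Fin r → k)
    {W' W : Submodule k M} [FiniteDimensional k W] (h : W' ≤ W) :
    kerDim T a W + Module.finrank k W' ≤ kerDim T a W' + Module.finrank k W := by
  have : FiniteDimensional k W' := Submodule.finiteDimensional_of_le h
  have h1 := Submodule.finrank_sup_add_finrank_inf_eq (W ⊓ LinearMap.ker (T a)) W'
  have h2 : W ⊓ LinearMap.ker (T a) ⊓ W' = W' ⊓ LinearMap.ker (T a) := by
    rw [inf_right_comm, inf_eq_right.mpr h]
  have h3 : Module.finrank k (W ⊓ LinearMap.ker (T a) ⊔ W' : Submodule k M) ≤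
    Module.finrank k W := Submodule.finrank_mono (sup_le inf_le_left h)
  rw [h2] at h1
  unfold kerDim
  omega

end KerDim

/-- Commuting operators `T a`, linear in `a ∈ k^r`, lowering by one the degree of finite-dimensional
subspaces `D j` whose positive-degree elements are not annihilated by all operators, with `D 0` at
most a line. This abstracts the Macaulay inverse system of a standard graded algebra. -/
structure MacaulaySystem (k M : Type*) [Field k] [AddCommGroup M] [Module k M] (r : ℕ) where
  T : (Fin r → k) →ₗ[k] M →ₗ[k] M
  D : ℕ → Submodule k M
  comm : ∀ a b x, T a (T b x) = T b (T a x)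
  mapsTo : ∀ j a, ∀ x ∈ D (j + 1), T a x ∈ D j
  eq_zero : ∀ j, ∀ x ∈ D (j + 1), (∀ a, T a x = 0) → x = 0
  finiteDimensional : ∀ j, FiniteDimensional k (D j)
  exists_smul : ∀ x ∈ D 0, ∀ y ∈ D 0, x ≠ 0 → ∃ c : k, y = c • x

namespace MacaulaySystem

variable {k M : Type*} [Field k] [AddCommGroup M] [Module k M] {r : ℕ}
  (S : MacaulaySystem k M r)

theorem finiteDimensional_of_le {j : ℕ} {W : Submodule k M} (hW : W ≤ S.D j) :
    FiniteDimensional k W :=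
  have := S.finiteDimensional j
  Submodule.finiteDimensional_of_le hW

theorem map_le {j : ℕ} {W : Submodule k M} (hW : W ≤ S.D (j + 1)) (a : Fin r → k) :
    W.map (S.T a) ≤ S.D j :=
  Submodule.map_le_iff_le_comap.mpr fun x hx => S.mapsTo j a x (hW hx)

theorem kerDim_symm (a b : Fin r → k) (W : Submodule k M) :
    kerDim S.T a (W ⊓ LinearMap.ker (S.T b)) = kerDim S.T b (W ⊓ LinearMap.ker (S.T a)) := by
  unfold kerDim
  rw [inf_right_comm]

theorem map_inf_ker_le (a b : Fin r → k) (W : Submodule k M) :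
    (W ⊓ LinearMap.ker (S.T a)).map (S.T b) ≤ W.map (S.T b) ⊓ LinearMap.ker (S.T a) := by
  rintro _ ⟨x, ⟨hx, hxa⟩, rfl⟩
  refine ⟨⟨x, hx, rfl⟩, ?_⟩
  have hxa : S.T a x = 0 := hxa
  change S.T a (S.T b x) = 0
  rw [S.comm, hxa, map_zero]

theorem exists_min_kerDim (W : Submodule k M) :
    ∃ a, ∀ b, kerDim S.T a W ≤ kerDim S.T b W :=
  ⟨Function.argmin fun a => kerDim S.T a W, fun b => Function.argmin_le (fun a => kerDim S.T a W) b⟩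

theorem exists_kerDim_eq_zero_of_finrank_le_one {j : ℕ} {W : Submodule k M}
    (hW : W ≤ S.D (j + 1)) (h : Module.finrank k W ≤ 1) : ∃ a, kerDim S.T a W = 0 := by
  have hfin := S.finiteDimensional_of_le hW
  by_cases h0 : ∀ a, W.map (S.T a) = ⊥
  · refine ⟨0, ?_⟩
    have : W = ⊥ := by
      rw [eq_bot_iff]
      intro x hx
      refine S.eq_zero j x (hW hx) fun a => ?_
      have := Submodule.mem_map_of_mem (f := S.T a) hx
      rwa [h0 a, Submodule.mem_bot] at this
    simp [kerDim, this]
  · push Not at h0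
    obtain ⟨a, ha⟩ := h0
    refine ⟨a, ?_⟩
    have h1 := finrank_map_add_kerDim S.T a W
    have h2 : Module.finrank k (W.map (S.T a)) ≠ 0 := by
      rwa [Ne, Submodule.finrank_eq_zero]
    omega

theorem le_choose_of_le_kerDim {m d : ℕ} {W : Submodule k M} (hW : W ≤ S.D (d + 1))
    (H : ∀ W' ≤ S.D (d + 1), Module.finrank k W' < Module.finrank k W →
      ∃ a, (m + d + 2) * kerDim S.T a W' ≤ (m + 1) * Module.finrank k W')
    (h : Module.finrank k W ≤ (m + 1 + (d + 1)).choose (d + 1)) {c : ℕ}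
    (hc : ∀ a, c ≤ kerDim S.T a W) : c ≤ (m + d + 1).choose (d + 1) := by
  have hfin := S.finiteDimensional_of_le hW
  rcases Nat.eq_zero_or_pos (Module.finrank k W) with h0 | hpos
  · have h1 := finrank_map_add_kerDim S.T 0 W
    have h2 := hc 0
    omega
  obtain ⟨W', hW', hW'n⟩ := exists_le_finrank_eq W (Nat.sub_le (Module.finrank k W) 1)
  obtain ⟨a, ha⟩ := H W' (hW'.trans hW) (by omega)
  have h1 := kerDim_le_add S.T a hW'
  have h2 := hc a
  have h3 := Nat.choose_mul_succ_eq (m + d + 1) (d + 1)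
  rw [show m + d + 1 + 1 - (d + 1) = m + 1 by omega,
    show m + d + 1 + 1 = m + 1 + (d + 1) by omega] at h3
  by_contra! hlt
  have h4 : (m + d + 1).choose (d + 1) ≤ kerDim S.T a W' := by omega
  have h5 : (m + d + 2) * (m + d + 1).choose (d + 1) ≤ (m + 1) * Module.finrank k W' :=
    (Nat.mul_le_mul_left _ h4).trans ha
  have h6 : (m + 1) * Module.finrank k W' < (m + 1) * (m + 1 + (d + 1)).choose (d + 1) :=
    Nat.mul_lt_mul_of_pos_left (by omega) (by omega)
  nlinarith

theorem map_iSup_map (a : Fin r → k) (W : Submodule k M) :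
    (⨆ b, W.map (S.T b)).map (S.T a) = ⨆ b, (W.map (S.T a)).map (S.T b) := by
  rw [Submodule.map_iSup]
  refine iSup_congr fun b => ?_
  rw [← Submodule.map_comp, ← Submodule.map_comp]
  congr 1
  ext x
  exact S.comm a b x

theorem iSup_map_le {j : ℕ} {W : Submodule k M} (hW : W ≤ S.D (j + 1)) :
    ⨆ b, W.map (S.T b) ≤ S.D j :=
  iSup_le fun b => S.map_le hW b

theorem exists_apply_apply_self_ne_zero (h2 : (2 : k) ≠ 0) {W : Submodule k M}
    (hW : W ≤ S.D 2) (hne : ⨆ b, W.map (S.T b) ≠ ⊥) : ∃ a, ∃ w ∈ W, S.T a (S.T a w) ≠ 0 := by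
  by_contra! h0
  have h00 : ∀ a b, ∀ w ∈ W, S.T a (S.T b w) = 0 := fun a b w hw => by
    have h1 := h0 (a + b) w hw
    simp only [map_add, LinearMap.add_apply, h0 a w hw, h0 b w hw, S.comm b a w] at h1
    rw [zero_add, add_zero, ← two_smul k] at h1
    exact (smul_eq_zero.mp h1).resolve_left h2
  refine hne (eq_bot_iff.mpr (iSup_le fun b => ?_))
  rintro _ ⟨w, hw, rfl⟩
  exact S.eq_zero 0 _ (S.mapsTo 1 b w (hW hw)) fun a => h00 a b w hw

theorem finrank_map_lt_of_ne {j : ℕ} {W : Submodule k M} (hW : W ≤ S.D (j + 1)) {a : Fin r → k}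
    (h : W.map (S.T a) ≠ ⨆ b, W.map (S.T b)) :
    Module.finrank k (W.map (S.T a)) < Module.finrank k (⨆ b, W.map (S.T b) : Submodule k M) :=
  have := S.finiteDimensional_of_le (S.iSup_map_le hW)
  Submodule.finrank_lt_finrank_of_lt
    (lt_of_le_of_ne (le_iSup (fun b => W.map (S.T b)) a) h)

variable [Infinite k]

/-- The inequality behind Green's hyperplane restriction theorem. -/
theorem kerDim_le_of_restriction {j : ℕ} {W : Submodule k M} (hW : W ≤ S.D j) {c b₁ b₂ : ℕ}
    (hc : ∀ a, c ≤ kerDim S.T a W) (hex : ∃ a, kerDim S.T a W = c)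
    (h₁ : ∀ a, kerDim S.T a W = c → ∃ b, kerDim S.T b (W ⊓ LinearMap.ker (S.T a)) ≤ b₁)
    (h₂ : ∀ a, kerDim S.T a W = c → ∃ b, kerDim S.T b (W.map (S.T a)) ≤ b₂) :
    c ≤ b₁ + b₂ := by
  have hfin := S.finiteDimensional_of_le hW
  have hfin' : ∀ a, FiniteDimensional k (W ⊓ LinearMap.ker (S.T a) : Submodule k M) := fun a =>
    Submodule.finiteDimensional_of_le inf_le_left
  obtain ⟨a₀, ha₀⟩ := hex
  obtain ⟨b₀, hb₀⟩ := h₁ a₀ ha₀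
  rw [kerDim_symm] at hb₀
  obtain ⟨a, hac, hab⟩ := ((eventually_kerDim_le S.T a₀ W).and
    (eventually_kerDim_le S.T a₀ (W ⊓ LinearMap.ker (S.T b₀)))).exists
  replace hac : kerDim S.T a W = c := le_antisymm (hac.trans ha₀.le) (hc a)
  replace hab := hab.trans hb₀
  rw [kerDim_symm] at hab
  obtain ⟨b₁', hb₁'⟩ := h₂ a hac
  obtain ⟨b, hb1, hb2⟩ := ((eventually_kerDim_le S.T b₀ (W ⊓ LinearMap.ker (S.T a))).and
    (eventually_kerDim_le S.T b₁' (W.map (S.T a)))).exists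
  have e1 := finrank_map_add_kerDim S.T a (W ⊓ LinearMap.ker (S.T b))
  have e2 : Module.finrank k ((W ⊓ LinearMap.ker (S.T b)).map (S.T a)) ≤
      kerDim S.T b (W.map (S.T a)) := Submodule.finrank_mono (S.map_inf_ker_le b a W)
  have e3 := hc b
  rw [kerDim_symm] at hb1
  have e4 : Module.finrank k (W ⊓ LinearMap.ker (S.T b) : Submodule k M) = kerDim S.T b W := rfl
  omega

/-- A linear form of Green's hyperplane restriction theorem. -/
theorem exists_kerDim_mul_le (d m : ℕ) (W : Submodule k M) (hW : W ≤ S.D d)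
    (h : Module.finrank k W ≤ (m + d).choose d) :
    ∃ a, (m + d) * kerDim S.T a W ≤ m * Module.finrank k W := by
  induction d generalizing m W with
  | zero =>
    have hfin := S.finiteDimensional_of_le hW
    have := finrank_map_add_kerDim S.T 0 W
    exact ⟨0, Nat.mul_le_mul_left _ (by omega)⟩
  | succ d ihd =>
    induction m generalizing W with
    | zero =>
      obtain ⟨a, ha⟩ := S.exists_kerDim_eq_zero_of_finrank_le_one hW (by simpa using h)
      exact ⟨a, by simp [ha]⟩
    | succ m ihm =>
      induction hn : Module.finrank k W using Nat.strong_induction_on generalizing W with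
      | _ n ihn =>
      subst hn
      have hfin := S.finiteDimensional_of_le hW
      obtain ⟨a₀, ha₀⟩ := S.exists_min_kerDim W
      refine ⟨a₀, ?_⟩
      have hc : kerDim S.T a₀ W ≤ (m + d + 1).choose (d + 1) :=
        S.le_choose_of_le_kerDim hW (fun W' hW' hlt => by
          obtain ⟨a, ha⟩ := ihn _ hlt W' hW' (hlt.le.trans h) rfl
          exact ⟨a, by rwa [show m + d + 2 = m + 1 + (d + 1) by omega]⟩) h ha₀
      have hmap := finrank_map_add_kerDim S.T a₀ W
      rcases le_or_gt (Module.finrank k (W.map (S.T a₀))) ((m + d + 1).choose d) with hlt | hgt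
      · have key := S.kerDim_le_of_restriction hW ha₀ ⟨a₀, rfl⟩
          (b₁ := m * kerDim S.T a₀ W / (m + d + 1))
          (b₂ := (m + 1) * Module.finrank k (W.map (S.T a₀)) / (m + d + 1)) ?_ ?_
        · have h1 := Nat.div_mul_le_self (m * kerDim S.T a₀ W) (m + d + 1)
          have h2 := Nat.div_mul_le_self ((m + 1) * Module.finrank k (W.map (S.T a₀))) (m + d + 1)
          have h3 := Nat.mul_le_mul_right (m + d + 1) key
          nlinarith
        · intro a ha
          obtain ⟨b, hb⟩ := ihm (W ⊓ LinearMap.ker (S.T a)) (inf_le_left.trans hW)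
            (ha.le.trans hc)
          refine ⟨b, (Nat.le_div_iff_mul_le (by omega)).mpr ?_⟩
          rw [← ha]
          calc _ = _ := mul_comm _ _
            _ ≤ _ := hb
        · intro a ha
          have hmap' := finrank_map_add_kerDim S.T a W
          have heq : Module.finrank k (W.map (S.T a)) = Module.finrank k (W.map (S.T a₀)) := by
            omega
          obtain ⟨b, hb⟩ := ihd (m + 1) (W.map (S.T a)) (S.map_le hW a)
            (by rw [heq, show m + 1 + d = m + d + 1 by omega]; exact hlt)
          refine ⟨b, (Nat.le_div_iff_mul_le (by omega)).mpr ?_⟩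
          rw [← heq]
          calc _ = _ := by ring
            _ ≤ _ := hb
      · have h1 := Nat.choose_succ_right_eq (m + d + 1) d
        rw [show m + d + 1 - d = m + 1 by omega] at h1
        nlinarith

theorem eventually_kerDim_le_choose {d m : ℕ} {W : Submodule k M} (hW : W ≤ S.D (d + 1))
    (h : Module.finrank k W ≤ (m + d + 1).choose (d + 1)) :
    ∀ᶠ a in genericFilter k r, kerDim S.T a W ≤ (m + d).choose (d + 1) := by
  have hfin := S.finiteDimensional_of_le hW
  obtain ⟨a, ha⟩ := S.exists_kerDim_mul_le (d + 1) m W hW h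
  filter_upwards [eventually_kerDim_le S.T a W] with b hb
  refine hb.trans ?_
  have h1 := Nat.choose_mul_succ_eq (m + d) (d + 1)
  rw [show m + d + 1 - (d + 1) = m by omega] at h1
  have h2 := Nat.mul_le_mul_left m h
  refine Nat.le_of_mul_le_mul_left (c := m + (d + 1)) ?_ (by omega)
  nlinarith

theorem eventually_kerDim_le_choose_of_add_one {e m : ℕ} {W : Submodule k M}
    (hW : W ≤ S.D (e + 2)) (h : Module.finrank k W = (m + e + 2).choose (e + 2) + 1) :
    ∀ᶠ a in genericFilter k r, kerDim S.T a W ≤ (m + e + 1).choose (e + 2) := by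
  have hfin := S.finiteDimensional_of_le hW
  suffices hmain : ∃ a, kerDim S.T a W ≤ (m + e + 1).choose (e + 2) by
    obtain ⟨a, ha⟩ := hmain
    filter_upwards [eventually_kerDim_le S.T a W] with b hb using hb.trans ha
  induction m using Nat.strong_induction_on generalizing W with
  | _ m ih =>
  by_contra! hn
  obtain ⟨W', hW', hW'n⟩ := exists_le_finrank_eq W (n := (m + e + 2).choose (e + 2)) (by omega)
  obtain ⟨a₀, ha₀⟩ := (S.eventually_kerDim_le_choose (d := e + 1) (m := m) (hW'.trans hW)
    hW'n.le).exists
  replace ha₀ : kerDim S.T a₀ W' ≤ (m + e + 1).choose (e + 2) := ha₀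
  have h1 := kerDim_le_add S.T a₀ hW'
  have ha₀' : kerDim S.T a₀ W = (m + e + 1).choose (e + 2) + 1 := by
    have := hn a₀
    omega
  have p1 : (m + e + 2).choose (e + 2) = (m + e + 1).choose (e + 1) + (m + e + 1).choose (e + 2) :=
    Nat.choose_succ_succ' _ _
  have p2 : (m + e + 1).choose (e + 2) = (m + e).choose (e + 1) + (m + e).choose (e + 2) :=
    Nat.choose_succ_succ' _ _
  have key := S.kerDim_le_of_restriction hW (c := (m + e + 1).choose (e + 2) + 1)
    (b₁ := (m + e).choose (e + 2)) (b₂ := (m + e).choose (e + 1)) hn ⟨a₀, ha₀'⟩ ?_ ?_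
  · omega
  · intro a ha
    rcases m with _ | m
    · have h0 : (0 + e + 1).choose (e + 2) = 0 := Nat.choose_eq_zero_of_lt (by omega)
      obtain ⟨b, hb⟩ := S.exists_kerDim_eq_zero_of_finrank_le_one
        (W := W ⊓ LinearMap.ker (S.T a)) (inf_le_left.trans hW) (by
          change kerDim S.T a W ≤ 1
          omega)
      exact ⟨b, by omega⟩
    · obtain ⟨b, hb⟩ := ih m (Nat.lt_succ_self m) (W := W ⊓ LinearMap.ker (S.T a))
        (inf_le_left.trans hW)
        (by rw [show m + e + 2 = m + 1 + e + 1 by omega]; exact ha)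
        (Submodule.finiteDimensional_of_le inf_le_left)
      exact ⟨b, by rwa [show m + 1 + e = m + e + 1 by omega]⟩
  · intro a ha
    have h2 := finrank_map_add_kerDim S.T a W
    exact (S.eventually_kerDim_le_choose (d := e) (m := m) (S.map_le hW a) (by omega)).exists

theorem exists_map_eq_iSup_succ {d m : ℕ}
    (ih : ∀ W ≤ S.D (d + 2), Module.finrank k W = (m + d + 3).choose (d + 2) →
      Module.finrank k (⨆ b, W.map (S.T b) : Submodule k M) = (m + d + 2).choose (d + 1) + 1 →
      ∃ a, W.map (S.T a) = ⨆ b, W.map (S.T b))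
    {W : Submodule k M} (hW : W ≤ S.D (d + 3))
    (h : Module.finrank k W = (m + d + 4).choose (d + 3))
    (hV : Module.finrank k (⨆ b, W.map (S.T b) : Submodule k M) =
      (m + d + 3).choose (d + 2) + 1) :
    ∃ a, W.map (S.T a) = ⨆ b, W.map (S.T b) := by
  by_contra! hne
  have hfin := S.finiteDimensional_of_le hW
  have hlt := fun a => S.finrank_map_lt_of_ne hW (hne a)
  have hVD := S.iSup_map_le hW
  have hsup : ∀ a, W.map (S.T a) ≤ ⨆ b, W.map (S.T b) := le_iSup fun b => W.map (S.T b)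
  have hsupmap := fun a => S.map_iSup_map a W
  generalize (⨆ b, W.map (S.T b)) = V at *
  have hfinV := S.finiteDimensional_of_le hVD
  have p1 : (m + d + 4).choose (d + 3) = (m + d + 3).choose (d + 2) + (m + d + 3).choose (d + 3) :=
    Nat.choose_succ_succ' _ _
  have p2 : (m + d + 3).choose (d + 3) = (m + d + 2).choose (d + 2) + (m + d + 2).choose (d + 3) :=
    Nat.choose_succ_succ' _ _
  have p3 : (m + d + 3).choose (d + 2) = (m + d + 2).choose (d + 1) + (m + d + 2).choose (d + 2) :=
    Nat.choose_succ_succ' _ _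
  obtain ⟨a', ha', haV⟩ := ((S.eventually_kerDim_le_choose (d := d + 2) (m := m + 1) hW
    (by rw [h, show m + 1 + (d + 2) + 1 = m + d + 4 by omega])).and
    (S.eventually_kerDim_le_choose_of_add_one (e := d) (m := m + 1) hVD
    (by rw [hV, show m + 1 + d + 2 = m + d + 3 by omega]))).exists
  rw [show m + 1 + (d + 2) = m + d + 3 by omega] at ha'
  replace ha' : kerDim S.T a' W ≤ (m + d + 3).choose (d + 3) := ha'
  rw [show m + 1 + d + 1 = m + d + 2 by omega] at haV
  have e1 := finrank_map_add_kerDim S.T a' W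
  have e2 := hlt a'
  have e3 : kerDim S.T a' W = (m + d + 3).choose (d + 3) := by omega
  have hfin' : FiniteDimensional k (W ⊓ LinearMap.ker (S.T a') : Submodule k M) :=
    Submodule.finiteDimensional_of_le inf_le_left
  have hfinV' : FiniteDimensional k (V ⊓ LinearMap.ker (S.T a') : Submodule k M) :=
    Submodule.finiteDimensional_of_le inf_le_left
  have hker : ∀ᶠ a in genericFilter k r,
      (W ⊓ LinearMap.ker (S.T a')).map (S.T a) = V ⊓ LinearMap.ker (S.T a') ∧
        (m + d + 2).choose (d + 2) ≤ kerDim S.T a' V := by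
    filter_upwards [S.eventually_kerDim_le_choose (d := d + 2) (m := m)
      (W := W ⊓ LinearMap.ker (S.T a')) (inf_le_left.trans hW) e3.le] with a ha
    replace ha : kerDim S.T a (W ⊓ LinearMap.ker (S.T a')) ≤ (m + d + 2).choose (d + 3) := ha
    have e4 := finrank_map_add_kerDim S.T a (W ⊓ LinearMap.ker (S.T a'))
    have e5 : Module.finrank k (W ⊓ LinearMap.ker (S.T a') : Submodule k M) =
      kerDim S.T a' W := rfl
    have e6 : (W ⊓ LinearMap.ker (S.T a')).map (S.T a) ≤ V ⊓ LinearMap.ker (S.T a') :=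
      (S.map_inf_ker_le a' a W).trans (inf_le_inf_right _ (hsup a))
    have e7 := Submodule.finrank_mono e6
    have e8 : Module.finrank k (V ⊓ LinearMap.ker (S.T a') : Submodule k M) =
      kerDim S.T a' V := rfl
    exact ⟨Submodule.eq_of_le_of_finrank_le e6 (by omega), by omega⟩
  obtain ⟨-, -, hge⟩ := hker.exists
  have e9 := finrank_map_add_kerDim S.T a' V
  have hW₁ := S.map_le hW a'
  have hfin₁ := S.finiteDimensional_of_le hW₁
  obtain ⟨a₁, ha₁⟩ := ih (W.map (S.T a')) hW₁ (by omega) (by rw [← hsupmap]; omega)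
  obtain ⟨a, ⟨hak, -⟩, har⟩ := (hker.and (eventually_finrank_map_ge S.T a₁ (W.map (S.T a')))).exists
  have hle : (W.map (S.T a')).map (S.T a) ≤ V.map (S.T a') := by
    rw [hsupmap]
    exact le_iSup (fun b => (W.map (S.T a')).map (S.T b)) a
  rw [ha₁, ← hsupmap] at har
  have heq := Submodule.eq_of_le_of_finrank_le hle har
  refine hne a (le_antisymm (hsup a) fun v hv => ?_)
  have hv' : S.T a' v ∈ (W.map (S.T a')).map (S.T a) := by
    rw [heq]
    exact Submodule.mem_map_of_mem hv
  obtain ⟨_, ⟨w, hw, rfl⟩, hwv⟩ := hv'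
  have hmem : v - S.T a w ∈ V ⊓ LinearMap.ker (S.T a') := by
    refine ⟨V.sub_mem hv (hsup a (Submodule.mem_map_of_mem hw)), ?_⟩
    change S.T a' (v - S.T a w) = 0
    rw [map_sub, S.comm, hwv, sub_self]
  rw [← hak] at hmem
  have hmem' := Submodule.map_mono (inf_le_left (a := W)) hmem
  simpa using Submodule.add_mem _ hmem' (Submodule.mem_map_of_mem (f := S.T a) hw)

theorem exists_map_eq_iSup_zero (h2 : (2 : k) ≠ 0) {m : ℕ} {W : Submodule k M} (hW : W ≤ S.D 2)
    (h : Module.finrank k W = (m + 3).choose 2)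
    (hV : Module.finrank k (⨆ b, W.map (S.T b) : Submodule k M) = (m + 2).choose 1 + 1) :
    ∃ a, W.map (S.T a) = ⨆ b, W.map (S.T b) := by
  by_contra! hne
  have hfin := S.finiteDimensional_of_le hW
  have hlt := fun a => S.finrank_map_lt_of_ne hW (hne a)
  have hrank := fun a => finrank_map_add_kerDim S.T a W
  have p1 : (m + 3).choose 2 = (m + 2).choose 1 + (m + 2).choose 2 := Nat.choose_succ_succ' _ _
  have p2 : (m + 2).choose 2 = (m + 1).choose 1 + (m + 1).choose 2 := Nat.choose_succ_succ' _ _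
  rw [Nat.choose_one_right] at p1 p2 hV
  obtain ⟨a₀, w, hw, ha₀⟩ := S.exists_apply_apply_self_ne_zero h2 hW (by
    intro hbot
    rw [hbot, finrank_bot] at hV
    omega)
  have hgood : ∀ᶠ a in genericFilter k r,
      kerDim S.T a W = (m + 2).choose 2 ∧ S.T a (S.T a w) ≠ 0 := by
    filter_upwards [S.eventually_kerDim_le_choose (d := 1) (m := m + 1) hW h.le,
      eventually_bilin_ne_zero (S.T.compl₂ (S.T.flip w)) a₀ ha₀] with a ha ha'
    refine ⟨?_, ha'⟩
    have := hlt a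
    have := hrank a
    replace ha : kerDim S.T a W ≤ (m + 2).choose 2 := ha
    omega
  have hpair : ∀ a b, kerDim S.T a W = (m + 2).choose 2 → S.T a (S.T a w) ≠ 0 →
      kerDim S.T b (W ⊓ LinearMap.ker (S.T a)) ≤ (m + 1).choose 2 →
      W.map (S.T a) ⊓ LinearMap.ker (S.T a) ≤ W.map (S.T b) ∧
        W.map (S.T a) ⊓ LinearMap.ker (S.T a) ≠ ⊥ := by
    intro a b ha haw hab
    have hfin' : FiniteDimensional k (W ⊓ LinearMap.ker (S.T a) : Submodule k M) :=
      Submodule.finiteDimensional_of_le inf_le_left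
    have hfin'' : FiniteDimensional k
        (W.map (S.T a) ⊓ LinearMap.ker (S.T a) : Submodule k M) :=
      Submodule.finiteDimensional_of_le inf_le_left
    have hincl : (W ⊓ LinearMap.ker (S.T a)).map (S.T b) ≤
        W.map (S.T a) ⊓ LinearMap.ker (S.T a) := by
      refine le_inf ?_ ((S.map_inf_ker_le a b W).trans inf_le_right)
      rintro _ ⟨v, ⟨hv, hva⟩, rfl⟩
      refine apply_mem_map_of_maximal_rank S.T a W (fun c => ?_) b hv hva
      have := hlt c
      have := hrank a
      omega
    have e1 := finrank_map_add_kerDim S.T b (W ⊓ LinearMap.ker (S.T a))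
    have e2 : Module.finrank k (W ⊓ LinearMap.ker (S.T a) : Submodule k M) = kerDim S.T a W := rfl
    have e3 := finrank_map_add_kerDim S.T a (W.map (S.T a))
    have e4 : Module.finrank k (W.map (S.T a) ⊓ LinearMap.ker (S.T a) : Submodule k M) =
      kerDim S.T a (W.map (S.T a)) := rfl
    have e5 : Module.finrank k ((W.map (S.T a)).map (S.T a)) ≠ 0 := by
      rw [Ne, Submodule.finrank_eq_zero]
      intro hbot
      have := Submodule.mem_map_of_mem (f := S.T a) (Submodule.mem_map_of_mem (f := S.T a) hw)
      rw [hbot] at this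
      exact haw this
    have e6 := hrank a
    have e7 := Submodule.finrank_mono hincl
    have heq := Submodule.eq_of_le_of_finrank_le hincl (by omega)
    refine ⟨heq ▸ Submodule.map_mono inf_le_left, fun hbot => ?_⟩
    rw [hbot, finrank_bot] at e4 e7
    omega
  obtain ⟨a', ha', haw'⟩ := hgood.exists
  have hpair' : ∀ᶠ a in genericFilter k r,
      (W.map (S.T a') ⊓ LinearMap.ker (S.T a') ≤ W.map (S.T a) ∧
        W.map (S.T a') ⊓ LinearMap.ker (S.T a') ≠ ⊥) ∧
      W.map (S.T a) ⊓ LinearMap.ker (S.T a) ≤ W.map (S.T a') := by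
    filter_upwards [hgood, S.eventually_kerDim_le_choose (d := 1) (m := m)
      (W := W ⊓ LinearMap.ker (S.T a')) (inf_le_left.trans hW) ha'.le] with a ha hab
    refine ⟨hpair a' a ha' haw' hab, (hpair a a' ha.1 ha.2 ?_).1⟩
    rw [S.kerDim_symm]
    exact hab
  obtain ⟨-, ⟨-, hbot⟩, -⟩ := hpair'.exists
  obtain ⟨z, ⟨hz, hza'⟩, hz0⟩ := Submodule.exists_mem_ne_zero_of_ne_bot hbot
  have hzD : z ∈ S.D 1 := S.map_le hW a' hz
  obtain ⟨b, hb⟩ : ∃ b, S.T b z ≠ 0 := by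
    by_contra! h0
    exact hz0 (S.eq_zero 0 z hzD h0)
  refine hne a' (le_antisymm (le_iSup (fun b => W.map (S.T b)) a') (iSup_le fun c => ?_))
  rintro _ ⟨x, hx, rfl⟩
  refine generic_le_submodule (S.T.flip x) (W.map (S.T a')) ?_ c
  filter_upwards [hpair', eventually_ne_zero (S.T.flip z) b hb] with a hp haz
  obtain ⟨⟨hle, -⟩, hle'⟩ := hp
  have hzmem : z ∈ W.map (S.T a) := hle ⟨hz, hza'⟩
  have hxmem : S.T a x ∈ W.map (S.T a) := Submodule.mem_map_of_mem hx
  obtain ⟨t, ht⟩ := S.exists_smul _ (S.mapsTo 0 a z hzD) _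
    (S.mapsTo 0 a _ (S.map_le hW a hxmem)) haz
  have hmem : S.T a x - t • z ∈ W.map (S.T a) ⊓ LinearMap.ker (S.T a) := by
    refine ⟨sub_mem hxmem (Submodule.smul_mem _ t hzmem), ?_⟩
    change S.T a (S.T a x - t • z) = 0
    rw [map_sub, map_smul, ht, sub_self]
  have := add_mem (hle' hmem) (Submodule.smul_mem _ t hz)
  rwa [sub_add_cancel] at this

theorem exists_map_eq_iSup (h2 : (2 : k) ≠ 0) (d m : ℕ) {W : Submodule k M}
    (hW : W ≤ S.D (d + 2)) (h : Module.finrank k W = (m + d + 3).choose (d + 2))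
    (hV : Module.finrank k (⨆ b, W.map (S.T b) : Submodule k M) =
      (m + d + 2).choose (d + 1) + 1) :
    ∃ a, W.map (S.T a) = ⨆ b, W.map (S.T b) := by
  induction d generalizing W with
  | zero => exact S.exists_map_eq_iSup_zero h2 hW h hV
  | succ d ih =>
    exact S.exists_map_eq_iSup_succ (fun W' hW' h' hV' => ih hW' h' hV') (m := m) hW
      (by rw [h]; congr 1) (by rw [hV]; congr 2)

end MacaulaySystem

section InverseSystem

variable {k : Type*} [Field k] {r : ℕ}

theorem homogeneousComponent_succ_mul {L : MvPolynomial (Fin r) k} (hL : L.IsHomogeneous 1)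
    (j : ℕ) (p : MvPolynomial (Fin r) k) :
    homogeneousComponent (j + 1) (L * p) = L * homogeneousComponent j p := by
  classical
  conv_lhs => rw [← sum_homogeneousComponent p, Finset.mul_sum, map_sum]
  have h1 : ∀ i, homogeneousComponent (j + 1) (L * homogeneousComponent i p) =
      if i = j then L * homogeneousComponent i p else 0 := fun i => by
    have h := homogeneousComponent_of_mem (m := j + 1)
      ((mem_homogeneousSubmodule _ _).mpr (hL.mul (homogeneousComponent_isHomogeneous i p)))
    rw [h]
    exact if_congr (by omega) rfl rfl
  simp only [h1, Finset.sum_ite_eq', Finset.mem_range]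
  split_ifs with hj
  · rfl
  · rw [homogeneousComponent_eq_zero _ _ (by omega), mul_zero]

theorem linForm_isHomogeneous (c : Fin r → k) : (linForm c).IsHomogeneous 1 :=
  IsHomogeneous.sum _ _ _ fun i _ => by
    simpa using (isHomogeneous_C (Fin r) (c i)).mul (isHomogeneous_X k i)

theorem linForm_single (i : Fin r) : linForm (Pi.single i (1 : k)) = X i := by
  classical
  rw [linForm, Finset.sum_eq_single i]
  · simp
  · intro j _ hj
    simp [hj]
  · simp

/-- The contraction action of linear forms on the graded dual of the polynomial ring. -/
noncomputable def contraction (k : Type*) [Field k] (r : ℕ) :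
    (Fin r → k) →ₗ[k] Module.Dual k (MvPolynomial (Fin r) k) →ₗ[k]
      Module.Dual k (MvPolynomial (Fin r) k) where
  toFun a := (LinearMap.mulLeft k (linForm a)).dualMap
  map_add' a b := by
    ext φ p
    simp [linForm, add_mul, Finset.sum_add_distrib]
  map_smul' c a := by
    ext1 φ
    refine LinearMap.ext fun p => ?_
    have : linForm (c • a) = c • linForm a := by
      simp [linForm, Finset.smul_sum, smul_eq_C_mul, mul_assoc]
    simp [this]

@[simp] theorem contraction_apply (a : Fin r → k)
    (φ : Module.Dual k (MvPolynomial (Fin r) k)) (p : MvPolynomial (Fin r) k) :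
    contraction k r a φ p = φ (linForm a * p) := rfl

/-- The projection of a polynomial to the degree-`j` component of `R/I`. -/
noncomputable def gradedProj (I : Ideal (MvPolynomial (Fin r) k)) (j : ℕ) :
    MvPolynomial (Fin r) k →ₗ[k] MvPolynomial (Fin r) k ⧸ I :=
  (Ideal.Quotient.mkₐ k I).toLinearMap ∘ₗ homogeneousComponent j

theorem mem_ker_gradedProj {I : Ideal (MvPolynomial (Fin r) k)} {j : ℕ}
    {p : MvPolynomial (Fin r) k} :
    p ∈ LinearMap.ker (gradedProj I j) ↔ homogeneousComponent j p ∈ I :=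
  Ideal.Quotient.eq_zero_iff_mem

theorem range_gradedProj (I : Ideal (MvPolynomial (Fin r) k)) (j : ℕ) :
    LinearMap.range (gradedProj I j) = gradedPiece k r I j := by
  rw [gradedProj, LinearMap.range_comp, gradedPiece]
  congr 1
  ext p
  refine ⟨?_, fun hp => ⟨p, ?_⟩⟩
  · rintro ⟨q, rfl⟩
    exact homogeneousComponent_isHomogeneous j q
  · rw [homogeneousComponent_of_mem hp, if_pos rfl]

/-- The degree-`j` component of the Macaulay inverse system of `I`. -/
noncomputable def inverseSystem (I : Ideal (MvPolynomial (Fin r) k)) (j : ℕ) :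
    Submodule k (Module.Dual k (MvPolynomial (Fin r) k)) :=
  (LinearMap.ker (gradedProj I j)).dualAnnihilator

/-- The degree-`j` component of the inverse system is dual to that of `R/I`. -/
noncomputable def dualGradedPieceEquiv (I : Ideal (MvPolynomial (Fin r) k)) (j : ℕ) :
    Module.Dual k (gradedPiece k r I j) ≃ₗ[k] inverseSystem I j :=
  ((gradedProj I j).quotKerEquivRange.trans
    (LinearEquiv.ofEq _ _ (range_gradedProj I j))).dualMap.trans
      (Submodule.dualQuotEquivDualAnnihilator _)

theorem finrank_inverseSystem (I : Ideal (MvPolynomial (Fin r) k)) (j : ℕ) :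
    Module.finrank k (inverseSystem I j) = hilb k r I j := by
  rw [← (dualGradedPieceEquiv I j).finrank_eq, Subspace.dual_finrank_eq, hilb]

theorem contraction_mem_inverseSystem {I : Ideal (MvPolynomial (Fin r) k)} {j : ℕ}
    (a : Fin r → k) {φ : Module.Dual k (MvPolynomial (Fin r) k)}
    (hφ : φ ∈ inverseSystem I (j + 1)) : contraction k r a φ ∈ inverseSystem I j := by
  refine (Submodule.mem_dualAnnihilator _).mpr fun p hp => ?_
  refine (Submodule.mem_dualAnnihilator _).mp hφ _ (mem_ker_gradedProj.mpr ?_)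
  rw [LinearMap.mulLeft_apply, homogeneousComponent_succ_mul (linForm_isHomogeneous a)]
  exact I.mul_mem_left _ (mem_ker_gradedProj.mp hp)

theorem inverseSystem_eq_zero {I : Ideal (MvPolynomial (Fin r) k)} {j : ℕ}
    {φ : Module.Dual k (MvPolynomial (Fin r) k)} (hφ : φ ∈ inverseSystem I (j + 1))
    (h : ∀ a, contraction k r a φ = 0) : φ = 0 := by
  classical
  refine (basisMonomials (Fin r) k).ext fun s => ?_
  rw [coe_basisMonomials, LinearMap.zero_apply]
  by_cases hs : s = 0
  · refine (Submodule.mem_dualAnnihilator _).mp hφ _ (mem_ker_gradedProj.mpr ?_)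
    subst hs
    change homogeneousComponent (j + 1) 1 ∈ I
    rw [homogeneousComponent_of_mem (isHomogeneous_one (Fin r) k), if_neg (by omega)]
    exact I.zero_mem
  · obtain ⟨i, hi⟩ := Finsupp.ne_iff.mp hs
    have hle : Finsupp.single i 1 ≤ s := by
      simpa using Nat.one_le_iff_ne_zero.mpr hi
    have := LinearMap.congr_fun (h (Pi.single i 1)) (monomial (s - Finsupp.single i 1) 1)
    rwa [contraction_apply, linForm_single, X, monomial_mul, one_mul,
      add_tsub_cancel_of_le hle] at this

theorem inverseSystem_zero_apply {I : Ideal (MvPolynomial (Fin r) k)}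
    {φ : Module.Dual k (MvPolynomial (Fin r) k)} (hφ : φ ∈ inverseSystem I 0)
    (p : MvPolynomial (Fin r) k) : φ p = coeff 0 p * φ 1 := by
  have h : φ (p - C (coeff 0 p)) = 0 := by
    refine (Submodule.mem_dualAnnihilator _).mp hφ _ (mem_ker_gradedProj.mpr ?_)
    simp [homogeneousComponent_zero]
  rw [map_sub, sub_eq_zero] at h
  rw [h, ← mul_one (C _), ← smul_eq_C_mul, map_smul, smul_eq_mul]

theorem inverseSystem_zero_exists_smul {I : Ideal (MvPolynomial (Fin r) k)}
    {φ ψ : Module.Dual k (MvPolynomial (Fin r) k)} (hφ : φ ∈ inverseSystem I 0)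
    (hψ : ψ ∈ inverseSystem I 0) (h0 : φ ≠ 0) : ∃ c : k, ψ = c • φ := by
  have h1 : φ 1 ≠ 0 := fun h => h0 (LinearMap.ext fun p => by
    rw [inverseSystem_zero_apply hφ, h, mul_zero, LinearMap.zero_apply])
  refine ⟨ψ 1 / φ 1, LinearMap.ext fun p => ?_⟩
  rw [LinearMap.smul_apply, inverseSystem_zero_apply hφ p, inverseSystem_zero_apply hψ p,
    smul_eq_mul]
  field_simp

/-- The inverse system of an ideal of finite colength as a `MacaulaySystem`. -/
noncomputable def macaulaySystem (I : Ideal (MvPolynomial (Fin r) k))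
    [Module.Finite k (MvPolynomial (Fin r) k ⧸ I)] :
    MacaulaySystem k (Module.Dual k (MvPolynomial (Fin r) k)) r where
  T := contraction k r
  D := inverseSystem I
  comm a b φ := LinearMap.ext fun p => by simp [mul_left_comm]
  mapsTo _ a _ hφ := contraction_mem_inverseSystem a hφ
  eq_zero _ _ hφ h := inverseSystem_eq_zero hφ h
  finiteDimensional j := Module.Finite.equiv (dualGradedPieceEquiv I j)
  exists_smul _ hφ _ hψ h0 := inverseSystem_zero_exists_smul hφ hψ h0

theorem mem_of_socDim_eq_zero {I : Ideal (MvPolynomial (Fin r) k)}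
    [Module.Finite k (MvPolynomial (Fin r) k ⧸ I)] {i : ℕ} (h : socDim k r I i = 0)
    {p : MvPolynomial (Fin r) k} (hp : p.IsHomogeneous i) (hX : ∀ j, X j * p ∈ I) : p ∈ I := by
  rw [socDim, Submodule.finrank_eq_zero] at h
  have hmem := Submodule.mem_map_of_mem (f := (Ideal.Quotient.mkₐ k I).toLinearMap)
    (show p ∈ homogeneousSubmodule (Fin r) k i ⊓ ⨅ j : Fin r, Submodule.comap
      (LinearMap.mulLeft k (X j)) (Submodule.restrictScalars k I) from
      ⟨hp, (Submodule.mem_iInf _).mpr hX⟩)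
  rw [h, Submodule.mem_bot] at hmem
  exact Ideal.Quotient.eq_zero_iff_mem.mp hmem

theorem iSup_map_contraction {I : Ideal (MvPolynomial (Fin r) k)}
    [Module.Finite k (MvPolynomial (Fin r) k ⧸ I)] {i : ℕ} (h : socDim k r I i = 0) :
    ⨆ a, (inverseSystem I (i + 1)).map (contraction k r a) = inverseSystem I i := by
  have hle : ⨆ a, (inverseSystem I (i + 1)).map (contraction k r a) ≤ inverseSystem I i :=
    (macaulaySystem I).iSup_map_le (le_refl (inverseSystem I (i + 1)))
  refine le_antisymm hle ?_
  have hfin := (macaulaySystem I).finiteDimensional_of_le hle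
  rw [← Subspace.dualCoannihilator_dualAnnihilator_eq
    (W := ⨆ a, (inverseSystem I (i + 1)).map (contraction k r a))]
  refine Submodule.dualAnnihilator_anti fun p hp => mem_ker_gradedProj.mpr ?_
  refine mem_of_socDim_eq_zero h (homogeneousComponent_isHomogeneous i p) fun j => ?_
  rw [← homogeneousComponent_succ_mul (isHomogeneous_X k j), ← mem_ker_gradedProj,
    ← Subspace.dualAnnihilator_dualCoannihilator_eq (W := LinearMap.ker (gradedProj I (i + 1))),
    Submodule.mem_dualCoannihilator]
  intro φ hφ
  have := (Submodule.mem_dualCoannihilator _).mp hp _ (Submodule.mem_iSup_of_mem (Pi.single j 1)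
    (Submodule.mem_map_of_mem hφ))
  rwa [contraction_apply, linForm_single] at this

theorem mem_of_linForm_mul_mem {I : Ideal (MvPolynomial (Fin r) k)} {i : ℕ} {a : Fin r → k}
    (h : (inverseSystem I (i + 1)).map (contraction k r a) = inverseSystem I i)
    {p : MvPolynomial (Fin r) k} (hp : p.IsHomogeneous i) (hI : linForm a * p ∈ I) : p ∈ I := by
  have hpi : homogeneousComponent i p = p := by rw [homogeneousComponent_of_mem hp, if_pos rfl]
  rw [← hpi, ← mem_ker_gradedProj,
    ← Subspace.dualAnnihilator_dualCoannihilator_eq (W := LinearMap.ker (gradedProj I i)),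
    Submodule.mem_dualCoannihilator]
  intro φ hφ
  change φ ∈ inverseSystem I i at hφ
  rw [← h] at hφ
  obtain ⟨ψ, hψ, rfl⟩ := hφ
  refine (Submodule.mem_dualAnnihilator _).mp hψ _ (mem_ker_gradedProj.mpr ?_)
  rw [LinearMap.mulLeft_apply, homogeneousComponent_succ_mul (linForm_isHomogeneous a), hpi]
  exact hI

/-- In a level algebra, injectivity of multiplication by a linear form propagates downwards. -/
theorem mem_of_mul_mem_of_level {I : Ideal (MvPolynomial (Fin r) k)}
    [Module.Finite k (MvPolynomial (Fin r) k ⧸ I)] {d : ℕ}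
    (hsoc : ∀ i < d, socDim k r I i = 0) {L : MvPolynomial (Fin r) k}
    (hL : ∀ p : MvPolynomial (Fin r) k, p.IsHomogeneous d → L * p ∈ I → p ∈ I)
    {i : ℕ} (hi : i ≤ d) {p : MvPolynomial (Fin r) k} (hp : p.IsHomogeneous i)
    (hI : L * p ∈ I) : p ∈ I := by
  induction hi using Nat.decreasingInduction generalizing p with
  | self => exact hL p hp hI
  | of_succ i hi ih =>
    refine mem_of_socDim_eq_zero (hsoc i hi) hp fun j => ih ?_ ?_
    · rw [add_comm]
      exact (isHomogeneous_X k j).mul hp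
    · rw [mul_left_comm]
      exact I.mul_mem_left _ hI

theorem finrank_map_mulLeft_eq_min {I : Ideal (MvPolynomial (Fin r) k)}
    [Module.Finite k (MvPolynomial (Fin r) k ⧸ I)] {L : MvPolynomial (Fin r) k}
    (hL : L.IsHomogeneous 1) {i : ℕ}
    (h : ∀ p : MvPolynomial (Fin r) k, p.IsHomogeneous i → L * p ∈ I → p ∈ I) :
    Module.finrank k (Submodule.map (LinearMap.mulLeft k (Ideal.Quotient.mk I L))
      (gradedPiece k r I i)) = min (hilb k r I i) (hilb k r I (i + 1)) := by
  have hle : Submodule.map (LinearMap.mulLeft k (Ideal.Quotient.mk I L)) (gradedPiece k r I i) ≤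
      gradedPiece k r I (i + 1) := by
    rintro _ ⟨_, ⟨p, hp, rfl⟩, rfl⟩
    exact ⟨L * p, by rw [add_comm]; exact hL.mul hp, map_mul (Ideal.Quotient.mkₐ k I) L p⟩
  have hinj : Module.finrank k (Submodule.map (LinearMap.mulLeft k (Ideal.Quotient.mk I L))
      (gradedPiece k r I i)) = hilb k r I i := by
    rw [← LinearMap.range_domRestrict]
    refine LinearMap.finrank_range_of_inj ((injective_iff_map_eq_zero _).mpr ?_)
    rintro ⟨_, p, hp, rfl⟩ hx
    refine Subtype.ext (Ideal.Quotient.eq_zero_iff_mem.mpr (h p hp ?_))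
    refine Ideal.Quotient.eq_zero_iff_mem.mp ?_
    rw [map_mul]
    exact hx
  rw [hinj, min_eq_left]
  rw [← hinj]
  exact Submodule.finrank_mono hle

theorem hilb_zero_le_one (I : Ideal (MvPolynomial (Fin r) k))
    [Module.Finite k (MvPolynomial (Fin r) k ⧸ I)] : hilb k r I 0 ≤ 1 := by
  rw [← finrank_inverseSystem]
  by_cases h : ∃ φ ∈ inverseSystem I 0, φ ≠ 0
  · obtain ⟨φ, hφ, h0⟩ := h
    refine finrank_le_one ⟨φ, hφ⟩ fun ψ => ?_
    obtain ⟨c, hc⟩ := inverseSystem_zero_exists_smul hφ ψ.2 h0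
    exact ⟨c, Subtype.ext hc.symm⟩
  · push Not at h
    rw [(Submodule.eq_bot_iff _).mpr h, finrank_bot]
    exact zero_le_one

end InverseSystem

/-- Proposition 3.7: a level algebra with Hilbert function `(h_0, …, h_d)`
satisfying `h_d = C(m+d, d)` and `h_{d-1} = C(m+d-1, d-1) + 1` for some
positive integer `m` has the weak Lefschetz property. -/
theorem level_wlp_binomial
    (k : Type*) [Field k] [Infinite k] (hchar : (2 : k) ≠ 0)
    (r d m : ℕ) (hd : 1 ≤ d) (hm : 1 ≤ m)
    (I : Ideal (MvPolynomial (Fin r) k))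
    (hlin : NoLinearForms I) (hLev : LevelAlg k r d I)
    (hhd : hilb k r I d = Nat.choose (m + d) d)
    (hhd1 : hilb k r I (d - 1) = Nat.choose (m + d - 1) (d - 1) + 1) :
    WLP k r d I := by
  obtain ⟨⟨-, hfin⟩, -, hsoc⟩ := hLev
  obtain _ | _ | d := d
  · omega
  · have h0 := hilb_zero_le_one I
    simp only [zero_add, Nat.sub_self, Nat.choose_zero_right] at hhd1
    omega
  obtain _ | m := m
  · omega
  rw [show d + 1 + 1 - 1 = d + 1 by omega, show m + 1 + (d + 1 + 1) - 1 = m + d + 2 by omega]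
    at hhd1
  rw [show m + 1 + (d + 1 + 1) = m + d + 3 by omega] at hhd
  have hsup := iSup_map_contraction (hsoc (d + 1) (by omega))
  obtain ⟨a, ha⟩ := (macaulaySystem I).exists_map_eq_iSup hchar d m
    (le_refl (inverseSystem I (d + 2))) (by rw [finrank_inverseSystem]; exact hhd) (by
      change Module.finrank k (⨆ b, (inverseSystem I (d + 2)).map (contraction k r b) :
        Submodule k _) = _
      rw [hsup, finrank_inverseSystem]
      exact hhd1)
  replace ha := ha.trans hsup
  refine ⟨linForm a, linForm_isHomogeneous a, fun i hi =>
    finrank_map_mulLeft_eq_min (linForm_isHomogeneous a) fun p hp hI => ?_⟩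
  exact mem_of_mul_mem_of_level (d := d + 1) (fun i hi => hsoc i (by omega))
    (fun q hq hqI => mem_of_linForm_mul_mem ha hq hqI) (by omega) hp hI
end

section
/- Let k be an infinite field with char k = 0. If (1, 14, a, a, 14, 1) is the Hilbert function of a standard graded artinian Gorenstein k-algebra, then a ≥ 14; that is, all Gorenstein h-vectors of the form (1, 14, a, a, 14, 1) are unimodal. -/
open MvPolynomial

open Module in
/-- The rank of `φ + s • ψ` drops below the rank of `φ` for only finitely many scalars `s`. -/
theorem LinearMap.finite_finrank_range_add_smul_lt {k M N : Type*} [Field k] [AddCommGroup M]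
    [Module k M] [AddCommGroup N] [Module k N] [FiniteDimensional k N] (φ ψ : M →ₗ[k] N) :
    {s : k | finrank k (LinearMap.range (φ + s • ψ)) < finrank k (LinearMap.range φ)}.Finite := by
  let b := finBasis k (LinearMap.range φ)
  choose v hv using fun i => (b i).2
  have hli : LinearIndependent k fun i => φ (v i) := by
    simp_rw [hv]
    exact b.linearIndependent.map' (LinearMap.range φ).subtype (Submodule.ker_subtype _)
  obtain ⟨π, hπ⟩ := (Fintype.linearCombination k fun i => φ (v i)).exists_leftInverse_of_injective
    (LinearMap.ker_eq_bot.2 (hli.fintypeLinearCombination_injective))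
  have hπv (i) : π (φ (v i)) = Pi.single i 1 := by
    have := LinearMap.congr_fun hπ (Pi.single i 1)
    simpa using this
  let B : Matrix (Fin (finrank k (LinearMap.range φ))) (Fin (finrank k (LinearMap.range φ))) k :=
    Matrix.of fun i => π (ψ (v i))
  let p : Polynomial k := (1 + (Polynomial.X : Polynomial k) • B.map Polynomial.C).det
  have hp (s : k) : p.eval s = (1 + s • B).det := by
    simp only [p, ← Polynomial.coe_evalRingHom, RingHom.map_det]
    congr 1
    ext i j
    rcases eq_or_ne i j with rfl | h <;> simp [*, mul_comm s]
  have hp0 : p ≠ 0 := by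
    intro h
    simpa [h] using hp 0
  refine (Polynomial.finite_setOfPred_isRoot hp0).subset fun s hs => ?_
  by_contra hroot
  have hdet : (1 + s • B).det ≠ 0 := by rwa [← hp]
  have hrows : LinearIndependent k (1 + s • B).row :=
    Matrix.linearIndependent_rows_of_det_ne_zero hdet
  have hrow : (1 + s • B).row = fun i => π ((φ + s • ψ) (v i)) := by
    ext i j
    simp [Matrix.row, hπv, B, Matrix.one_apply, Pi.single_apply, eq_comm]
  rw [hrow] at hrows
  have hli' : LinearIndependent k fun i => (φ + s • ψ) (v i) := LinearIndependent.of_comp π hrows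
  have hle : finrank k (LinearMap.range φ) ≤ finrank k (LinearMap.range (φ + s • ψ)) := by
    have h := finrank_span_eq_card hli'
    rw [Fintype.card_fin] at h
    exact h.ge.trans <| Submodule.finrank_mono <|
      Submodule.span_le.2 (Set.range_subset_iff.2 fun i => ⟨_, rfl⟩)
  exact absurd hs (not_lt.2 hle)

section

open Module

variable {k S : Type*} [Field k] [CommRing S] [Algebra k S]

/-- The elements of `W` annihilated by `x`. -/
def Submodule.annihilatedBy (x : S) (W : Submodule k S) : Submodule k S :=
  W ⊓ LinearMap.ker (LinearMap.mulLeft k x)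

/-- The least nullity of multiplication by an element of `V` on `W`. -/
noncomputable def Submodule.genericNullity (V W : Submodule k S) : ℕ :=
  ⨅ x : V, finrank k (W.annihilatedBy (x : S))

namespace Submodule

theorem annihilatedBy_le (x : S) (W : Submodule k S) : W.annihilatedBy x ≤ W := inf_le_left

theorem map_mulLeft_le_mul {x : S} {V : Submodule k S} (hx : x ∈ V) (W : Submodule k S) :
    W.map (LinearMap.mulLeft k x) ≤ V * W := by
  rintro _ ⟨w, hw, rfl⟩
  exact mul_mem_mul hx hw

theorem genericNullity_le {x : S} {V : Submodule k S} (hx : x ∈ V) (W : Submodule k S) :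
    V.genericNullity W ≤ finrank k (W.annihilatedBy x) :=
  ciInf_le (OrderBot.bddBelow _) (⟨x, hx⟩ : V)

theorem exists_le_finrank_eq {n : ℕ} {W : Submodule k S} (hn : n ≤ finrank k W) :
    ∃ U ≤ W, finrank k U = n := by
  obtain ⟨f, hf⟩ := exists_linearIndependent_of_le_finrank hn
  refine ⟨(span k (Set.range f)).map W.subtype, map_subtype_le W _, ?_⟩
  rw [finrank_map_subtype_eq, finrank_span_eq_card hf, Fintype.card_fin]

variable [FiniteDimensional k S]

theorem finrank_map_mulLeft_add (x : S) (W : Submodule k S) :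
    finrank k (W.map (LinearMap.mulLeft k x)) + finrank k (W.annihilatedBy x) = finrank k W := by
  have h := ((LinearMap.mulLeft k x).domRestrict W).finrank_range_add_finrank_ker
  rw [LinearMap.range_domRestrict, LinearMap.ker_domRestrict] at h
  rw [← h, annihilatedBy, ← Submodule.map_comap_subtype, finrank_map_subtype_eq]

theorem genericNullity_le_finrank (V W : Submodule k S) : V.genericNullity W ≤ finrank k W :=
  (genericNullity_le V.zero_mem W).trans (finrank_mono (annihilatedBy_le _ W))

theorem finite_finrank_annihilatedBy_lt (x y : S) (W : Submodule k S) :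
    {s : k | finrank k (W.annihilatedBy x) <
      finrank k (W.annihilatedBy (x + s • y))}.Finite := by
  refine (LinearMap.finite_finrank_range_add_smul_lt ((LinearMap.mulLeft k x).domRestrict W)
    ((LinearMap.mulLeft k y).domRestrict W)).subset fun s hs => ?_
  have h : (LinearMap.mulLeft k x).domRestrict W + s • (LinearMap.mulLeft k y).domRestrict W =
      (LinearMap.mulLeft k (x + s • y)).domRestrict W := by
    ext w
    simp [add_mul]
  have h₁ := W.finrank_map_mulLeft_add x
  have h₂ := W.finrank_map_mulLeft_add (x + s • y)
  rw [Set.mem_ofPred_eq] at hs ⊢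
  rw [h, LinearMap.range_domRestrict, LinearMap.range_domRestrict]
  omega

variable [Infinite k]

/-- Finitely many subspaces admit a common generic element of `V`. -/
theorem exists_finrank_annihilatedBy_eq_genericNullity (V : Submodule k S)
    (l : List (Submodule k S)) :
    ∃ x ∈ V, ∀ W ∈ l, finrank k (W.annihilatedBy x) = V.genericNullity W := by
  induction l with
  | nil => exact ⟨0, V.zero_mem, by simp⟩
  | cons W l ih =>
    obtain ⟨x, hx, hxl⟩ := ih
    obtain ⟨⟨y, hy⟩, hyW⟩ := ciInf_mem fun x : V => finrank k (W.annihilatedBy (x : S))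
    have hfin : (⋃ U ∈ {U | U ∈ l}, {s : k | finrank k (U.annihilatedBy x) <
        finrank k (U.annihilatedBy (x + s • (y - x)))}).Finite :=
      l.finite_toSet.biUnion fun U _ => finite_finrank_annihilatedBy_lt x (y - x) U
    have hfin' := (finite_finrank_annihilatedBy_lt y (x - y) W).preimage
      (f := fun s : k => 1 - s) (sub_right_injective.injOn)
    obtain ⟨s, hs⟩ := (hfin.union hfin').exists_notMem
    simp only [Set.mem_union, Set.mem_iUnion, Set.mem_ofPred_eq, Set.mem_preimage, not_or,
      not_exists, not_lt] at hs
    have hmem : x + s • (y - x) ∈ V := V.add_mem hx (V.smul_mem s (V.sub_mem hy hx))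
    have heq : y + (1 - s) • (x - y) = x + s • (y - x) := by module
    refine ⟨_, hmem, fun U hU => le_antisymm ?_ (genericNullity_le hmem U)⟩
    rcases List.mem_cons.1 hU with rfl | hU
    · rw [← heq]
      exact hs.2.trans hyW.le
    · exact (hs.1 U hU).trans (hxl U hU).le

theorem finrank_le_finrank_mul_add_genericNullity (V W : Submodule k S) :
    finrank k W ≤ finrank k (V * W : Submodule k S) + V.genericNullity W := by
  obtain ⟨x, hx, h⟩ := V.exists_finrank_annihilatedBy_eq_genericNullity [W]
  rw [← h W (by simp), ← W.finrank_map_mulLeft_add x]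
  gcongr
  exact finrank_mono (map_mulLeft_le_mul hx W)

theorem finrank_add_genericNullity_le (V : Submodule k S) {U W : Submodule k S} (h : U ≤ W) :
    finrank k U + V.genericNullity W ≤ finrank k W + V.genericNullity U := by
  obtain ⟨x, -, hx⟩ := V.exists_finrank_annihilatedBy_eq_genericNullity [U, W]
  rw [← hx U (by simp), ← hx W (by simp), ← U.finrank_map_mulLeft_add x,
    ← W.finrank_map_mulLeft_add x]
  have := finrank_mono (map_mono (f := LinearMap.mulLeft k x) h)
  omega

/-- The restriction inequality behind Green's hyperplane restriction theorem. -/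
theorem exists_genericNullity_le_add (V W : Submodule k S) :
    ∃ W₁ W₂ : Submodule k S, W₁ ≤ W ∧ W₂ ≤ V * W ∧ finrank k W₁ = V.genericNullity W ∧
      finrank k W₂ + V.genericNullity W = finrank k W ∧
      V.genericNullity W ≤ V.genericNullity W₁ + V.genericNullity W₂ := by
  obtain ⟨x, hx, h⟩ := V.exists_finrank_annihilatedBy_eq_genericNullity [W]
  replace h := h W (by simp)
  set W₁ := W.annihilatedBy x with hW₁
  set W₂ := W.map (LinearMap.mulLeft k x) with hW₂
  refine ⟨W₁, W₂, annihilatedBy_le x W, map_mulLeft_le_mul hx W, h, ?_, ?_⟩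
  · rw [← h, finrank_map_mulLeft_add]
  obtain ⟨y, hy, hyl⟩ := V.exists_finrank_annihilatedBy_eq_genericNullity [W, W₁, W₂]
  rw [← hyl W (by simp), ← hyl W₁ (by simp), ← hyl W₂ (by simp),
    ← (W.annihilatedBy y).finrank_map_mulLeft_add x, add_comm]
  gcongr
  · refine finrank_mono fun w hw => ?_
    exact ⟨⟨hw.1.1, hw.2⟩, hw.1.2⟩
  · refine finrank_mono ?_
    rintro _ ⟨w, hw, rfl⟩
    refine ⟨⟨w, hw.1, rfl⟩, ?_⟩
    have : y * w = 0 := hw.2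
    simp [mul_left_comm y x w, this]

end Submodule

/-- A family of subspaces that behaves like the graded pieces of a graded algebra generated in
degree one whose socle vanishes below degree `e`. -/
structure SocleFreeBelow (G : ℕ → Submodule k S) (e : ℕ) : Prop where
  mul_le (i : ℕ) : G 1 * G i ≤ G (i + 1)
  eq_zero {i : ℕ} (hi : i < e) {w : S} (hw : w ∈ G i) (h : ∀ x ∈ G 1, x * w = 0) : w = 0

namespace SocleFreeBelow

variable {G : ℕ → Submodule k S} {e : ℕ}

theorem mul_le_of_le (hG : SocleFreeBelow G e) {i : ℕ} {W : Submodule k S} (hW : W ≤ G i) :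
    G 1 * W ≤ G (i + 1) :=
  (mul_le_mul_right hW _).trans (hG.mul_le i)

/-- The pairing between complementary degrees is nondegenerate. -/
theorem eq_zero_of_forall_mul_eq_zero (hG : SocleFreeBelow G e) {d i : ℕ} (h : d + i = e)
    {w : S} (hw : w ∈ G i) (hmul : ∀ y ∈ G d, w * y = 0) (h₀ : (1 : S) ∈ G 0) : w = 0 := by
  induction d generalizing i w with
  | zero => simpa using hmul 1 h₀
  | succ d ih =>
    refine hG.eq_zero (by omega) hw fun x hx => ih (i := i + 1) (by omega)
      (hG.mul_le i (Submodule.mul_mem_mul hx hw)) fun y hy => ?_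
    rw [mul_comm x w, mul_assoc]
    exact hmul _ (hG.mul_le d (Submodule.mul_mem_mul hx hy))

variable [FiniteDimensional k S]

theorem genericNullity_lt_finrank (hG : SocleFreeBelow G e) {i : ℕ} (hi : i < e)
    {W : Submodule k S} (hW : W ≤ G i) (hpos : 0 < finrank k W) :
    (G 1).genericNullity W < finrank k W := by
  obtain ⟨w, hw, hw0⟩ := W.exists_mem_ne_zero_of_ne_bot (by rintro rfl; simp at hpos)
  obtain ⟨x, hx, hxw⟩ : ∃ x ∈ G 1, x * w ≠ 0 := by
    by_contra! h
    exact hw0 (hG.eq_zero hi (hW hw) h)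
  refine (Submodule.genericNullity_le hx W).trans_lt (Submodule.finrank_lt_finrank_of_lt ?_)
  exact lt_of_le_of_ne (W.annihilatedBy_le x) fun h => hxw (h.ge hw).2

/-- Socle degree `5`: multiplication by `x` on `G 3` has rank at least that on `G 1`. -/
theorem finrank_map_mulLeft_le (hG : SocleFreeBelow G 5) (h₀ : (1 : S) ∈ G 0)
    (h₅ : finrank k (G 5) = 1) {x : S} (hx : x ∈ G 1) :
    finrank k ((G 1).map (LinearMap.mulLeft k x)) ≤
      finrank k ((G 3).map (LinearMap.mulLeft k x)) := by
  obtain ⟨ε, hε⟩ := LinearMap.exists_extend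
    (LinearEquiv.ofFinrankEq (G 5) k (by rw [h₅, finrank_self])).toLinearMap
  have hε0 {u : S} (hu : u ∈ G 5) (h : ε u = 0) : u = 0 := by
    have h' := LinearMap.congr_fun hε ⟨u, hu⟩
    rw [LinearMap.comp_apply, Submodule.subtype_apply, h] at h'
    simpa using h'.symm
  set W := (G 3).map (LinearMap.mulLeft k x)
  let B : G 1 →ₗ[k] W →ₗ[k] k := ((LinearMap.mul k S).compr₂ ε).domRestrict₁₂ (G 1) W
  have hker : (LinearMap.ker B).map (G 1).subtype ≤ (G 1).annihilatedBy x := by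
    rintro _ ⟨⟨w, hw⟩, hwB, rfl⟩
    refine ⟨hw, hG.eq_zero_of_forall_mul_eq_zero (d := 3) rfl
      (hG.mul_le 1 (Submodule.mul_mem_mul hx hw)) (fun y hy => ?_) h₀⟩
    rw [LinearMap.mulLeft_apply, Submodule.subtype_apply, mul_comm x w, mul_assoc]
    refine hε0 ?_ (LinearMap.congr_fun (LinearMap.mem_ker.1 hwB) ⟨x * y, y, hy, rfl⟩)
    exact hG.mul_le 4 (Submodule.mul_mem_mul hw (hG.mul_le 3 (Submodule.mul_mem_mul hx hy)))
  have hk := Submodule.finrank_mono hker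
  rw [Submodule.finrank_map_subtype_eq] at hk
  have hr := B.finrank_range_add_finrank_ker
  have hle : finrank k (LinearMap.range B) ≤ finrank k W :=
    (Submodule.finrank_le _).trans_eq Subspace.dual_finrank_eq
  have := (G 1).finrank_map_mulLeft_add x
  omega

variable [Infinite k]

theorem genericNullity_eq_zero (hG : SocleFreeBelow G e) {d i : ℕ} (h : d + i = e)
    {W : Submodule k S} (hW : W ≤ G i) (hd : finrank k W ≤ d) :
    (G 1).genericNullity W = 0 := by
  induction d generalizing i W with
  | zero => exact Nat.eq_zero_of_le_zero (((G 1).genericNullity_le_finrank W).trans hd)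
  | succ d ih =>
    by_contra hne
    obtain ⟨W₁, W₂, hW₁, hW₂, h₁, h₂, hle⟩ := (G 1).exists_genericNullity_le_add W
    have := hG.genericNullity_lt_finrank (by omega) (hW₁.trans hW) (by omega)
    have := ih (i := i + 1) (by omega) (hW₂.trans (hG.mul_le_of_le hW)) (by omega)
    omega

/-- A subspace of dimension at least `d` in codegree `d` generically has rank at least `d`. -/
theorem genericNullity_add_le (hG : SocleFreeBelow G e) {d i n : ℕ} (h : d + i = e)
    {W : Submodule k S} (hW : W ≤ G i) (hn : n ≤ d) (hnW : n ≤ finrank k W) :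
    (G 1).genericNullity W + n ≤ finrank k W := by
  obtain ⟨U, hUW, hU⟩ := Submodule.exists_le_finrank_eq hnW
  have h₀ := hG.genericNullity_eq_zero h (hUW.trans hW) (hU.le.trans hn)
  have := (G 1).finrank_add_genericNullity_le hUW
  omega

theorem genericNullity_le (hG : SocleFreeBelow G e) {d i : ℕ} (h : d + i = e)
    {W : Submodule k S} (hW : W ≤ G i) (hd : 2 * finrank k W ≤ d * (d + 3)) :
    (G 1).genericNullity W ≤ d := by
  induction d generalizing i W with
  | zero => exact ((G 1).genericNullity_le_finrank W).trans (by omega)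
  | succ d ih =>
    by_contra! hlt
    obtain ⟨W₁, W₂, hW₁, hW₂, h₁, h₂, hle⟩ := (G 1).exists_genericNullity_le_add W
    have := hG.genericNullity_add_le h (hW₁.trans hW) le_rfl (by omega)
    have := ih (i := i + 1) (by omega) (hW₂.trans (hG.mul_le_of_le hW)) (by nlinarith)
    omega

theorem genericNullity_lt (hG : SocleFreeBelow G e) {d i : ℕ} (h : d + i = e)
    {W : Submodule k S} (hW : W ≤ G i) (hd : 2 * (finrank k W + 1) ≤ d * (d + 3)) :
    (G 1).genericNullity W < d := by
  obtain _ | d := d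
  · omega
  by_contra! hlt
  obtain ⟨W₁, W₂, hW₁, hW₂, h₁, h₂, hle⟩ := (G 1).exists_genericNullity_le_add W
  have := hG.genericNullity_add_le h (hW₁.trans hW) le_rfl (by omega)
  have := hG.genericNullity_le (d := d) (i := i + 1) (by omega)
    (hW₂.trans (hG.mul_le_of_le hW)) (by nlinarith)
  omega

theorem genericNullity_le_one (hG : SocleFreeBelow G e) {d i : ℕ} (h : d + i = e)
    {W : Submodule k S} (hW : W ≤ G i) (hd : finrank k W ≤ 2 * d - 1) :
    (G 1).genericNullity W ≤ 1 := by
  induction d generalizing i W with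
  | zero => exact ((G 1).genericNullity_le_finrank W).trans (by omega)
  | succ d ih =>
    by_contra! hlt
    obtain ⟨W₁, W₂, hW₁, hW₂, h₁, h₂, hle⟩ := (G 1).exists_genericNullity_le_add W
    obtain _ | d := d
    · omega
    have := hG.genericNullity_add_le h (n := 2) (hW₁.trans hW) (by omega) (by omega)
    have := ih (i := i + 1) (by omega) (hW₂.trans (hG.mul_le_of_le hW)) (by omega)
    omega

/-- A graded algebra whose socle vanishes below degree `5` and whose Hilbert function is
`(1, 14, a, a, *, 1)` has `14 ≤ a`. -/
theorem fourteen_le_finrank (hG : SocleFreeBelow G 5) (h₀ : (1 : S) ∈ G 0)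
    (hgen : G 2 ≤ G 1 * G 1) (h₁ : finrank k (G 1) = 14)
    (h₃ : finrank k (G 3) = finrank k (G 2)) (h₅ : finrank k (G 5) = 1) :
    14 ≤ finrank k (G 2) := by
  by_contra! hlt
  set t := (G 1).genericNullity (G 1) with ht
  have ht4 : t ≤ 4 := hG.genericNullity_le (d := 4) rfl le_rfl (by omega)
  have key {x : S} (hx : x ∈ G 1) (hxt : finrank k ((G 1).annihilatedBy x) = t) :
      t = 4 ∧ finrank k (G 1 * (G 1).annihilatedBy x : Submodule k S) = 4 ∧ 13 ≤ finrank k (G 2) := by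
    set K := (G 1).annihilatedBy x with hK
    have hK1 : K ≤ G 1 := (G 1).annihilatedBy_le x
    have hVK : G 1 * K ≤ G 2 := hG.mul_le_of_le hK1
    have hVVK : G 1 * (G 1 * K) ≤ (G 3).annihilatedBy x := by
      refine le_inf (hG.mul_le_of_le hVK) ?_
      have : G 1 * (G 1 * K) = K * (G 1 * G 1) := by rw [mul_comm K, mul_assoc]
      rw [this, Submodule.mul_le]
      intro w hw y _
      have : x * w = 0 := hw.2
      simp [← mul_assoc, this]
    have hs := Submodule.finrank_mono hVVK
    have hr₃ := (G 3).finrank_map_mulLeft_add x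
    have hr₁ := (G 1).finrank_map_mulLeft_add x
    rw [← hK] at hr₁
    have hr := hG.finrank_map_mulLeft_le h₀ h₅ hx
    have hK0 := hG.genericNullity_eq_zero (d := 4) rfl hK1 (by omega)
    have hu := (G 1).finrank_le_finrank_mul_add_genericNullity K
    have hv := (G 1).finrank_le_finrank_mul_add_genericNullity (G 1 * K)
    have hu4 : 4 ≤ finrank k (G 1 * K : Submodule k S) := by
      by_contra! h
      have := hG.genericNullity_eq_zero (d := 3) rfl hVK (by omega)
      omega
    have h3 := hG.genericNullity_add_le (d := 3) rfl hVK le_rfl (by omega)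
    have hu5 : finrank k (G 1 * K : Submodule k S) ≤ 4 := by
      by_contra! h
      obtain ⟨U, hU, hU5⟩ := Submodule.exists_le_finrank_eq (n := 5) h
      have := hG.genericNullity_le_one (d := 3) rfl (hU.trans hVK) (by omega)
      have := (G 1).finrank_add_genericNullity_le hU
      omega
    omega
  obtain ⟨x, hx, hxt⟩ := (G 1).exists_finrank_annihilatedBy_eq_genericNullity [G 1]
  replace hxt := hxt (G 1) (by simp)
  obtain ⟨ht, -, h13⟩ := key hx hxt
  set K := (G 1).annihilatedBy x with hK
  have hKV : K ≤ G 1 := (G 1).annihilatedBy_le x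
  have hK0 := hG.genericNullity_eq_zero (d := 4) rfl hKV (by omega)
  let T : Set S := {y | y ∈ G 1 ∧ finrank k ((G 1).annihilatedBy y) = t ∧
    finrank k (K.annihilatedBy y) = 0}
  let P : Submodule k S := ⨆ y ∈ T, (G 1).annihilatedBy y
  have hPV : P ≤ G 1 := iSup₂_le fun y _ => (G 1).annihilatedBy_le y
  have hP : P = G 1 := by
    refine Submodule.eq_of_le_of_finrank_le hPV ?_
    by_contra! h
    have hP3 := hG.genericNullity_lt (d := 4) rfl hPV (by omega)
    obtain ⟨y, hy, hyl⟩ := (G 1).exists_finrank_annihilatedBy_eq_genericNullity [G 1, K, P]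
    have hyT : y ∈ T := ⟨hy, hyl (G 1) (by simp), (hyl K (by simp)).trans hK0⟩
    have hle : (G 1).annihilatedBy y ≤ P.annihilatedBy y :=
      le_inf (le_iSup₂_of_le y hyT le_rfl) inf_le_right
    have := Submodule.finrank_mono hle
    have := hyl P (by simp)
    have := hyT.2.1
    omega
  have hVV : G 1 * G 1 ≤ (G 1).map (LinearMap.mulLeft k x) := by
    nth_rewrite 2 [← hP]
    simp only [P, Submodule.mul_iSup]
    refine iSup₂_le fun y hy => ?_
    have hker : ((G 1).annihilatedBy y).annihilatedBy x ≤ K.annihilatedBy y :=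
      fun w hw => ⟨⟨hw.1.1, hw.2⟩, hw.1.2⟩
    have h0 := Submodule.finrank_mono hker
    have h1 := ((G 1).annihilatedBy y).finrank_map_mulLeft_add x
    have h2 := hy.2.1
    have h3 := hy.2.2
    have h4 := (key hy.1 hy.2.1).2.1
    rw [← Submodule.eq_of_le_of_finrank_le
      (Submodule.map_mulLeft_le_mul hx ((G 1).annihilatedBy y)) (by omega)]
    exact Submodule.map_mono ((G 1).annihilatedBy_le y)
  have := Submodule.finrank_mono (hgen.trans hVV)
  have := (G 1).finrank_map_mulLeft_add x
  rw [← hK] at this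
  omega

end SocleFreeBelow

end

section

variable {k : Type*} [Field k] {r : ℕ} (I : Ideal (MvPolynomial (Fin r) k))

theorem one_mem_gradedPiece_zero : (1 : MvPolynomial (Fin r) k ⧸ I) ∈ gradedPiece k r I 0 :=
  ⟨1, isHomogeneous_one _ _, rfl⟩

theorem gradedPiece_one_mul_le (i : ℕ) :
    gradedPiece k r I 1 * gradedPiece k r I i ≤ gradedPiece k r I (i + 1) := by
  rw [Submodule.mul_le]
  rintro _ ⟨f, hf, rfl⟩ _ ⟨g, hg, rfl⟩
  exact ⟨f * g, add_comm 1 i ▸ IsHomogeneous.mul hf hg, map_mul (Ideal.Quotient.mkₐ k I) f g⟩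

theorem gradedPiece_two_le_mul :
    gradedPiece k r I 2 ≤ gradedPiece k r I 1 * gradedPiece k r I 1 := by
  have h : homogeneousSubmodule (Fin r) k 1 ^ 2 = homogeneousSubmodule (Fin r) k 2 :=
    homogeneousSubmodule_one_pow _ 2
  rw [gradedPiece, ← h, pow_two]
  exact (Submodule.map_mul _ _ (Ideal.Quotient.mkₐ k I)).le

variable {I}

theorem eq_zero_of_socDim_eq_zero [Module.Finite k (MvPolynomial (Fin r) k ⧸ I)] {i : ℕ}
    (h : socDim k r I i = 0) {w : MvPolynomial (Fin r) k ⧸ I} (hw : w ∈ gradedPiece k r I i)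
    (hmul : ∀ x ∈ gradedPiece k r I 1, x * w = 0) : w = 0 := by
  obtain ⟨f, hf, rfl⟩ := hw
  rw [socDim, Submodule.finrank_eq_zero] at h
  rw [← Submodule.mem_bot k, ← h]
  refine ⟨f, ⟨hf, (Submodule.mem_iInf _).2 fun j => ?_⟩, rfl⟩
  have := hmul _ ⟨X j, isHomogeneous_X k j, rfl⟩
  exact Ideal.Quotient.eq_zero_iff_mem.1 this

theorem Gorenstein.socleFreeBelow {e : ℕ} (h : Gorenstein k r e I) :
    SocleFreeBelow (gradedPiece k r I) e :=
  have := h.1.2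
  { mul_le := gradedPiece_one_mul_le I
    eq_zero := fun hi _ hw hmul => eq_zero_of_socDim_eq_zero (h.2.2.1 _ hi) hw hmul }

end

/-- Proposition 3.9 (i): in characteristic zero, all Gorenstein `h`-vectors of
the form `(1, 14, a, a, 14, 1)` are unimodal, i.e. `a ≥ 14`. -/
theorem gorenstein_1_14_a_a_14_1_unimodal
    (k : Type*) [Field k] [Infinite k] [CharZero k]
    (r a : ℕ)
    (I : Ideal (MvPolynomial (Fin r) k))
    (hlin : NoLinearForms I) (hGor : Gorenstein k r 5 I)
    (h0 : hilb k r I 0 = 1) (h1 : hilb k r I 1 = 14) (h2 : hilb k r I 2 = a)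
    (h3 : hilb k r I 3 = a) (h4 : hilb k r I 4 = 14) (h5 : hilb k r I 5 = 1) :
    14 ≤ a := by
  subst h2
  have := hGor.1.2
  exact hGor.socleFreeBelow.fourteen_le_finrank (one_mem_gradedPiece_zero I)
    (gradedPiece_two_le_mul I) h1 h3 h5
end

section
/- Let k be an infinite field with char k = 0. Then every Hilbert function of a standard graded artinian Gorenstein k-algebra with socle degree 5 and codimension r ≤ 14 is unimodal. -/
open MvPolynomial

section GenericFilter

variable {k : Type*} [Field k] {n : ℕ}

/-- The filter of subsets of `kⁿ` that contain a nonempty basic Zariski-open set. -/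
def zariskiGeneric (k : Type*) [Field k] (n : ℕ) : Filter (Fin n → k) where
  sets := {s | ∃ Q : MvPolynomial (Fin n) k, Q ≠ 0 ∧ ∀ c, eval c Q ≠ 0 → c ∈ s}
  univ_sets := ⟨1, one_ne_zero, fun _ _ => Set.mem_univ _⟩
  sets_of_superset := fun ⟨Q, hQ, h⟩ hst => ⟨Q, hQ, fun c hc => hst (h c hc)⟩
  inter_sets := fun ⟨Q, hQ, h⟩ ⟨Q', hQ', h'⟩ => ⟨Q * Q', mul_ne_zero hQ hQ', fun c hc => by
    rw [map_mul] at hc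
    exact ⟨h c (left_ne_zero_of_mul hc), h' c (right_ne_zero_of_mul hc)⟩⟩

instance zariskiGeneric_neBot [Infinite k] : (zariskiGeneric k n).NeBot := by
  refine ⟨fun h => ?_⟩
  obtain ⟨Q, hQ, hQ'⟩ := Filter.empty_mem_iff_bot.mpr h
  refine hQ (MvPolynomial.funext fun c => ?_)
  by_contra hc
  exact hQ' c (by simpa using hc)

theorem eventually_eval_ne_zero {Q : MvPolynomial (Fin n) k} {c₀ : Fin n → k}
    (h : eval c₀ Q ≠ 0) : ∀ᶠ c in zariskiGeneric k n, eval c Q ≠ 0 :=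
  ⟨Q, fun hQ => h (by simp [hQ]), fun _ hc => hc⟩

variable {E : Type*} [AddCommGroup E] [Module k E]

/-- The linear polynomial representing a linear functional on `kⁿ`. -/
theorem exists_eval_eq_linear (f : (Fin n → k) →ₗ[k] k) :
    ∃ Q : MvPolynomial (Fin n) k, ∀ c, eval c Q = f c := by
  refine ⟨∑ i, C (f (Pi.single i 1)) * X i, fun c => ?_⟩
  conv_rhs => rw [LinearMap.pi_apply_eq_sum_univ f c]
  simp only [map_sum, map_mul, eval_C, eval_X, smul_eq_mul]
  refine Finset.sum_congr rfl fun i _ => ?_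
  rw [mul_comm]
  congr 2
  funext j
  simp [Pi.single_apply, eq_comm]

theorem eventually_linearIndependent_s14 {s : ℕ} (f : Fin s → (Fin n → k) →ₗ[k] E)
    {c₀ : Fin n → k} (h : LinearIndependent k fun i => f i c₀) :
    ∀ᶠ c in zariskiGeneric k n, LinearIndependent k fun i => f i c := by
  classical
  let b := Module.Basis.extend h.linearIndepOn_id
  have hφ : ∀ j : Fin s, ∃ φ : E →ₗ[k] k, ∀ i, φ (f i c₀) = if i = j then 1 else 0 := by
    intro j
    refine ⟨b.coord ⟨f j c₀, Module.Basis.subset_extend _ ⟨j, rfl⟩⟩, fun i => ?_⟩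
    have hb : b ⟨f i c₀, Module.Basis.subset_extend h.linearIndepOn_id ⟨i, rfl⟩⟩ = f i c₀ :=
      Module.Basis.extend_apply_self _ _
    rw [← hb, Module.Basis.coord_apply, Module.Basis.repr_self, Finsupp.single_apply]
    simp [Subtype.mk.injEq, h.injective.eq_iff]
  choose φ hφ using hφ
  choose q hq using fun i j => exists_eval_eq_linear (φ j ∘ₗ f i)
  have hdet : ∀ c, eval c (Matrix.det (Matrix.of q)) =
      Matrix.det (Matrix.of fun i j => φ j (f i c)) := by
    intro c
    rw [RingHom.map_det]
    congr 1
    ext i j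
    simp [hq]
  have h0 : eval c₀ (Matrix.det (Matrix.of q)) ≠ 0 := by
    rw [hdet]
    have : (Matrix.of fun i j => φ j (f i c₀)) = (1 : Matrix (Fin s) (Fin s) k) := by
      ext i j
      simp [hφ, Matrix.one_apply]
    simp [this]
  filter_upwards [eventually_eval_ne_zero h0] with c hc
  rw [hdet] at hc
  have := Matrix.linearIndependent_rows_of_det_ne_zero hc
  exact LinearIndependent.of_comp (LinearMap.pi φ) this

theorem eventually_apply_ne_zero (f : (Fin n → k) →ₗ[k] E) {c₀ : Fin n → k} (h : f c₀ ≠ 0) :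
    ∀ᶠ c in zariskiGeneric k n, f c ≠ 0 := by
  have := eventually_linearIndependent_s14 (s := 1) (fun _ => f) (c₀ := c₀)
    (linearIndependent_unique_iff.mpr h)
  filter_upwards [this] with c hc
  exact linearIndependent_unique_iff.mp hc

theorem forall_mem_of_eventually_mem [Infinite k] (f : (Fin n → k) →ₗ[k] E) (W : Submodule k E)
    (h : ∀ᶠ c in zariskiGeneric k n, f c ∈ W) (c : Fin n → k) : f c ∈ W := by
  by_contra hc
  have := eventually_apply_ne_zero (W.mkQ ∘ₗ f) (c₀ := c)
    (by simpa [Submodule.Quotient.mk_eq_zero] using hc)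
  obtain ⟨c', h1, h2⟩ := (h.and this).exists
  exact h2 (by simpa [Submodule.Quotient.mk_eq_zero] using h1)

theorem forall_eq_zero_of_eventually_eq_zero [Infinite k] (f : (Fin n → k) →ₗ[k] E)
    (h : ∀ᶠ c in zariskiGeneric k n, f c = 0) (c : Fin n → k) : f c = 0 := by
  simpa using forall_mem_of_eventually_mem f ⊥ (by simpa using h) c

end GenericFilter

section Multiplication

variable {k A : Type*} [Field k] [CommRing A] [Algebra k A]

/-- The elements of `V` annihilated by `a`. -/
def annIn (a : A) (V : Submodule k A) : Submodule k A :=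
  V ⊓ LinearMap.ker (LinearMap.mulLeft k a)

/-- The image of `V` under multiplication by `a`. -/
def mulImage (a : A) (V : Submodule k A) : Submodule k A :=
  V.map (LinearMap.mulLeft k a)

theorem mem_annIn {a x : A} {V : Submodule k A} : x ∈ annIn a V ↔ x ∈ V ∧ a * x = 0 := by
  simp [annIn]

theorem mul_mem_mulImage {a x : A} {V : Submodule k A} (hx : x ∈ V) : a * x ∈ mulImage a V :=
  ⟨x, hx, by simp⟩

theorem mem_mulImage {a y : A} {V : Submodule k A} :
    y ∈ mulImage a V ↔ ∃ x ∈ V, a * x = y := by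
  simp [mulImage]

theorem mulImage_le {a : A} {V W : Submodule k A} (h : ∀ x ∈ V, a * x ∈ W) :
    mulImage a V ≤ W := by
  rintro _ ⟨x, hx, rfl⟩
  exact h x hx

variable [FiniteDimensional k A]

theorem finrank_mulImage_add_finrank_annIn (a : A) (V : Submodule k A) :
    Module.finrank k (mulImage a V) + Module.finrank k (annIn a V) = Module.finrank k V := by
  have := LinearMap.finrank_range_add_finrank_ker ((LinearMap.mulLeft k a).domRestrict V)
  rw [LinearMap.range_domRestrict] at this
  rw [← this, mulImage]
  congr 1
  rw [LinearMap.ker_domRestrict, annIn, ← Submodule.map_comap_subtype]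
  exact (Submodule.equivMapOfInjective _ V.injective_subtype _).finrank_eq.symm

theorem eq_bot_of_finrank_le_zero {V : Submodule k A} (h : Module.finrank k V ≤ 0) : V = ⊥ :=
  Submodule.finrank_eq_zero.mp (by omega)

variable {n : ℕ} (φ : (Fin n → k) →ₗ[k] A)

theorem eventually_finrank_mulImage_le (V : Submodule k A) (c₀ : Fin n → k) :
    ∀ᶠ c in zariskiGeneric k n,
      Module.finrank k (mulImage (φ c₀) V) ≤ Module.finrank k (mulImage (φ c) V) := by
  let b := Module.finBasis k (mulImage (φ c₀) V)
  have hv : ∀ i, ∃ x ∈ V, φ c₀ * x = b i := fun i => mem_mulImage.mp (b i).2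
  choose v hv hvb using hv
  let f : Fin (Module.finrank k (mulImage (φ c₀) V)) → (Fin n → k) →ₗ[k] A :=
    fun i => LinearMap.mulRight k (v i) ∘ₗ φ
  have h0 : LinearIndependent k fun i => f i c₀ := by
    have := b.linearIndependent.map' (mulImage (φ c₀) V).subtype (Submodule.ker_subtype _)
    convert! this using 2 with i
    simp [f, hvb]
  filter_upwards [eventually_linearIndependent_s14 f h0] with c hc
  have hc' : LinearIndependent k
      (fun i => (⟨φ c * v i, mul_mem_mulImage (hv i)⟩ : mulImage (φ c) V)) := by
    refine LinearIndependent.of_comp (mulImage (φ c) V).subtype ?_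
    convert! hc using 2
  simpa using hc'.fintype_card_le_finrank

theorem eventually_finrank_annIn_le (V : Submodule k A) (c₀ : Fin n → k) :
    ∀ᶠ c in zariskiGeneric k n,
      Module.finrank k (annIn (φ c) V) ≤ Module.finrank k (annIn (φ c₀) V) := by
  filter_upwards [eventually_finrank_mulImage_le φ V c₀] with c hc
  have := finrank_mulImage_add_finrank_annIn (φ c) V
  have := finrank_mulImage_add_finrank_annIn (φ c₀) V
  omega

end Multiplication

section GreenBounds

variable {k A : Type*} [Field k] [CommRing A] [Algebra k A] {n : ℕ}

/-- The subalgebra generated by the image of `φ`, graded by powers of that image, has no socle in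
degrees below `e`. -/
def SocleFreeBelow_s14 (φ : (Fin n → k) →ₗ[k] A) (e : ℕ) : Prop :=
  ∀ j < e, ∀ x ∈ LinearMap.range φ ^ j, (∀ c, φ c * x = 0) → x = 0

variable {φ : (Fin n → k) →ₗ[k] A} {e : ℕ}

theorem mul_mem_range_pow_succ {x : A} {j : ℕ} (hx : x ∈ LinearMap.range φ ^ j)
    (c : Fin n → k) : φ c * x ∈ LinearMap.range φ ^ (j + 1) := by
  rw [pow_succ']
  exact Submodule.mul_mem_mul ⟨c, rfl⟩ hx

theorem mulImage_le_range_pow_succ {V : Submodule k A} {j : ℕ} (hV : V ≤ LinearMap.range φ ^ j)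
    (c : Fin n → k) : mulImage (φ c) V ≤ LinearMap.range φ ^ (j + 1) :=
  mulImage_le fun _ hx => mul_mem_range_pow_succ (hV hx) c

theorem eq_zero_of_eventually_mul_eq_zero [Infinite k] (h : SocleFreeBelow_s14 φ e) {j : ℕ}
    (hj : j < e) {x : A} (hx : x ∈ LinearMap.range φ ^ j)
    (h0 : ∀ᶠ c in zariskiGeneric k n, φ c * x = 0) : x = 0 :=
  h j hj x hx (forall_eq_zero_of_eventually_eq_zero (LinearMap.mulRight k x ∘ₗ φ) h0)

theorem eventually_mul_ne_zero [Infinite k] (h : SocleFreeBelow_s14 φ e) {j : ℕ} (hj : j < e)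
    {x : A} (hx : x ∈ LinearMap.range φ ^ j) (h0 : x ≠ 0) :
    ∀ᶠ c in zariskiGeneric k n, φ c * x ≠ 0 := by
  have : ∃ c, φ c * x ≠ 0 := by
    by_contra! hc
    exact h0 (h j hj x hx hc)
  obtain ⟨c, hc⟩ := this
  exact eventually_apply_ne_zero (LinearMap.mulRight k x ∘ₗ φ) hc

variable [Infinite k] [FiniteDimensional k A]

theorem eventually_finrank_annIn_le_of_finrank_le_add (h : SocleFreeBelow_s14 φ e) {d : ℕ} :
    ∀ {s j : ℕ} {V : Submodule k A}, j + d = e → V ≤ LinearMap.range φ ^ j →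
      Module.finrank k V ≤ d + s →
      ∀ᶠ c in zariskiGeneric k n, Module.finrank k (annIn (φ c) V) ≤ s := by
  induction d with
  | zero =>
    intro s j V _ _ hd
    refine Filter.Eventually.of_forall fun c => ?_
    have := finrank_mulImage_add_finrank_annIn (φ c) V
    omega
  | succ d ih =>
    intro s j V hj hV hd
    by_cases hex : ∃ c, Module.finrank k (annIn (φ c) V) ≤ s
    · obtain ⟨c₀, hc₀⟩ := hex
      filter_upwards [eventually_finrank_annIn_le φ V c₀] with c hc using hc.trans hc₀
    exfalso
    push Not at hex
    obtain ⟨c₀, hmin⟩ : ∃ c₀, ∀ c, Module.finrank k (annIn (φ c₀) V) ≤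
        Module.finrank k (annIn (φ c) V) := by
      obtain ⟨c₀, hc₀⟩ := exists_minimalFor_of_wellFoundedLT (fun _ : Fin n → k => True)
        (fun c => Module.finrank k (annIn (φ c) V)) ⟨0, trivial⟩
      exact ⟨c₀, fun c => (le_total _ _).elim id fun h' => hc₀.2 trivial h'⟩
    have hrk := finrank_mulImage_add_finrank_annIn (φ c₀) V
    have hbig := hex c₀
    have hbot : ∀ x ∈ annIn (φ c₀) V, x = 0 := by
      intro x hx
      refine eq_zero_of_eventually_mul_eq_zero h (by omega) (hV (mem_annIn.mp hx).1) ?_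
      filter_upwards [ih (s := 0) (j := j + 1) (by omega) (mulImage_le_range_pow_succ hV c₀)
        (by omega)] with c hc
      have hle : annIn (φ c) V ≤ annIn (φ c₀) V := by
        intro y hy
        rw [mem_annIn] at hy ⊢
        refine ⟨hy.1, ?_⟩
        have : φ c₀ * y ∈ annIn (φ c) (mulImage (φ c₀) V) :=
          mem_annIn.mpr ⟨mul_mem_mulImage hy.1, by rw [mul_left_comm, hy.2, mul_zero]⟩
        rw [eq_bot_of_finrank_le_zero hc] at this
        exact (Submodule.mem_bot k).mp this
      rw [← Submodule.eq_of_le_of_finrank_le hle (hmin c)] at hx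
      exact (mem_annIn.mp hx).2
    rw [(Submodule.eq_bot_iff _).mpr hbot, finrank_bot] at hbig
    omega

theorem eventually_annIn_eq_bot (h : SocleFreeBelow_s14 φ e) {d j : ℕ} {V : Submodule k A}
    (hj : j + d = e) (hV : V ≤ LinearMap.range φ ^ j) (hd : Module.finrank k V ≤ d) :
    ∀ᶠ c in zariskiGeneric k n, annIn (φ c) V = ⊥ := by
  filter_upwards [eventually_finrank_annIn_le_of_finrank_le_add h (s := 0) hj hV hd] with c hc
  exact eq_bot_of_finrank_le_zero hc

theorem eventually_le_finrank_mulImage (h : SocleFreeBelow_s14 φ e) {d j : ℕ} {V : Submodule k A}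
    (hj : j + d = e) (hV : V ≤ LinearMap.range φ ^ j) (hd : d ≤ Module.finrank k V) :
    ∀ᶠ c in zariskiGeneric k n, d ≤ Module.finrank k (mulImage (φ c) V) := by
  obtain ⟨f, hf⟩ := exists_linearIndependent_of_le_finrank hd
  have hf' := hf.map' V.subtype (Submodule.ker_subtype _)
  set W := Submodule.span k (Set.range (V.subtype ∘ f))
  have hWV : W ≤ V := Submodule.span_le.mpr (by rintro _ ⟨i, rfl⟩; exact (f i).2)
  have hW : Module.finrank k W = d :=
    (finrank_span_eq_card hf').trans (by simp)
  filter_upwards [eventually_annIn_eq_bot h hj (hWV.trans hV) hW.le] with c hc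
  have h1 := finrank_mulImage_add_finrank_annIn (φ c) W
  rw [hc, finrank_bot] at h1
  have h2 : Module.finrank k (mulImage (φ c) W) ≤ Module.finrank k (mulImage (φ c) V) :=
    Submodule.finrank_mono (Submodule.map_mono hWV)
  omega

theorem eventually_finrank_annIn_le_of_lt_choose (h : SocleFreeBelow_s14 φ e) {d : ℕ} :
    ∀ {j : ℕ} {V : Submodule k A}, j + d = e → V ≤ LinearMap.range φ ^ j →
      2 * (Module.finrank k V + 1) ≤ (d + 1) * (d + 2) →
      ∀ᶠ c in zariskiGeneric k n, Module.finrank k (annIn (φ c) V) ≤ d := by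
  induction d with
  | zero =>
    intro j V _ _ hd
    refine Filter.Eventually.of_forall fun c => ?_
    have := finrank_mulImage_add_finrank_annIn (φ c) V
    omega
  | succ d ih =>
    intro j V hj hV hd
    by_cases hex : ∃ c, Module.finrank k (annIn (φ c) V) ≤ d + 1
    · obtain ⟨c₀, hc₀⟩ := hex
      filter_upwards [eventually_finrank_annIn_le φ V c₀] with c hc using hc.trans hc₀
    exfalso
    push Not at hex
    obtain ⟨⟨c₀, c₁⟩, hmin⟩ : ∃ p : (Fin n → k) × (Fin n → k), ∀ c c',
        Module.finrank k (annIn (φ p.2) (annIn (φ p.1) V)) ≤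
        Module.finrank k (annIn (φ c') (annIn (φ c) V)) := by
      obtain ⟨p, hp⟩ := exists_minimalFor_of_wellFoundedLT
        (fun _ : (Fin n → k) × (Fin n → k) => True)
        (fun p => Module.finrank k (annIn (φ p.2) (annIn (φ p.1) V))) ⟨(0, 0), trivial⟩
      exact ⟨p, fun c c' => (le_total _ _).elim id fun h' =>
        hp.2 (j := (c, c')) trivial h'⟩
    have hV₀ := mulImage_le_range_pow_succ hV c₀
    have hih := ih (j := j + 1) (by omega) hV₀ (by
      have := finrank_mulImage_add_finrank_annIn (φ c₀) V
      have := hex c₀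
      nlinarith)
    obtain ⟨c', hc'1, hc'2⟩ :=
      (hih.and (eventually_finrank_annIn_le φ (annIn (φ c₀) V) c₁)).exists
    have hsub : mulImage (φ c₀) (annIn (φ c') V) ≤ annIn (φ c') (mulImage (φ c₀) V) := by
      refine mulImage_le fun y hy => ?_
      rw [mem_annIn] at hy
      exact mem_annIn.mpr ⟨mul_mem_mulImage hy.1, by rw [mul_left_comm, hy.2, mul_zero]⟩
    have hsmall : Module.finrank k (mulImage (φ c₀) (annIn (φ c') V)) ≤ d :=
      (Submodule.finrank_mono hsub).trans hc'1
    have hzero : annIn (φ c₀) (annIn (φ c') V) = ⊥ := by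
      rw [Submodule.eq_bot_iff]
      intro x hx
      have hxV : x ∈ V := (mem_annIn.mp (mem_annIn.mp hx).1).1
      refine eq_zero_of_eventually_mul_eq_zero h (by omega) (hV hxV) ?_
      filter_upwards [eventually_annIn_eq_bot h (j := j + 1) (by omega)
        (fun y hy => hV₀ (mem_annIn.mp (hsub hy)).1) hsmall] with c'' hc''
      have hle : annIn (φ c'') (annIn (φ c') V) ≤ annIn (φ c') (annIn (φ c₀) V) := by
        intro y hy
        have hy1 := (mem_annIn.mp hy).1
        have hy2 := (mem_annIn.mp hy).2
        have : φ c₀ * y ∈ annIn (φ c'') (mulImage (φ c₀) (annIn (φ c') V)) :=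
          mem_annIn.mpr ⟨mul_mem_mulImage hy1, by rw [mul_left_comm, hy2, mul_zero]⟩
        rw [hc'', Submodule.mem_bot] at this
        rw [mem_annIn] at hy1
        exact mem_annIn.mpr ⟨mem_annIn.mpr ⟨hy1.1, this⟩, hy1.2⟩
      have heq := Submodule.eq_of_le_of_finrank_le hle (hc'2.trans (hmin c' c''))
      have hx' : x ∈ annIn (φ c') (annIn (φ c₀) V) := by
        simp only [mem_annIn] at hx ⊢
        tauto
      rw [← heq] at hx'
      exact (mem_annIn.mp hx').2
    have := finrank_mulImage_add_finrank_annIn (φ c₀) (annIn (φ c') V)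
    rw [hzero, finrank_bot] at this
    have := hex c'
    omega

end GreenBounds

section SecondDerivatives

variable {k A : Type*} [Field k] [CommRing A] [Algebra k A] {n : ℕ}
  {φ : (Fin n → k) →ₗ[k] A} {K V : Submodule k A}

theorem eq_zero_of_mul_mul_eq_zero (h : SocleFreeBelow_s14 φ 5) (hK : K ≤ LinearMap.range φ ^ 1)
    (hKV : ∀ x ∈ K, ∀ c c', φ c' * (φ c * x) ∈ V) {c : Fin n → k} (hc : annIn (φ c) V = ⊥)
    {x : A} (hx : x ∈ K) (hcx : φ c * x = 0) : x = 0 := by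
  refine h 1 (by norm_num) x (hK hx) fun c₁ => ?_
  refine h 2 (by norm_num) _ (mul_mem_range_pow_succ (hK hx) _) fun c₂ => ?_
  have : φ c₂ * (φ c₁ * x) ∈ annIn (φ c) V := by
    refine mem_annIn.mpr ⟨hKV x hx _ _, ?_⟩
    linear_combination (φ c₂ * φ c₁) * hcx
  rwa [hc, Submodule.mem_bot] at this

variable [FiniteDimensional k A]

theorem annIn_ne_bot_of_finrank_lt (h : SocleFreeBelow_s14 φ 5) (hK : K ≤ LinearMap.range φ ^ 1)
    (hKV : ∀ x ∈ K, ∀ c c', φ c' * (φ c * x) ∈ V)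
    (hlt : Module.finrank k V < Module.finrank k K) (c : Fin n → k) :
    annIn (φ c) V ≠ ⊥ := by
  intro hc
  have hann : annIn (φ c * φ c) K = ⊥ := by
    rw [Submodule.eq_bot_iff]
    intro x hx
    rw [mem_annIn] at hx
    refine eq_zero_of_mul_mul_eq_zero h hK hKV hc hx.1 ?_
    refine h 2 (by norm_num) _ (mul_mem_range_pow_succ (hK hx.1) _) fun c₁ => ?_
    have : φ c₁ * (φ c * x) ∈ annIn (φ c) V := by
      refine mem_annIn.mpr ⟨hKV x hx.1 _ _, ?_⟩
      linear_combination φ c₁ * hx.2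
    rwa [hc, Submodule.mem_bot] at this
  have h1 := finrank_mulImage_add_finrank_annIn (φ c * φ c) K
  rw [hann, finrank_bot] at h1
  have h2 : mulImage (φ c * φ c) K ≤ V :=
    mulImage_le fun x hx => by rw [mul_assoc]; exact hKV x hx _ _
  have := Submodule.finrank_mono h2
  omega

/-- A nonzero element `q` killed by `φ c` whose products with linear forms span a line. -/
theorem exists_rank_one_of_finrank_lt (h : SocleFreeBelow_s14 φ 5) (hK : K ≤ LinearMap.range φ ^ 1)
    (hV : V ≤ LinearMap.range φ ^ 3)
    (hKV : ∀ x ∈ K, ∀ c c', φ c' * (φ c * x) ∈ V)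
    (hlt : Module.finrank k V < Module.finrank k K) {c : Fin n → k}
    (hcK : annIn (φ c) K = ⊥) (hcV : Module.finrank k (annIn (φ c) V) ≤ 1) :
    ∃ q ∈ V, q ≠ 0 ∧ ∃ u ∈ LinearMap.range φ ^ 4, u ≠ 0 ∧ φ c * u = 0 ∧
      ∀ c', ∃ t : k, φ c' * q = t • u := by
  obtain ⟨x, hxK, hx0, hccx⟩ : ∃ x ∈ K, x ≠ 0 ∧ φ c * (φ c * x) = 0 := by
    have h1 := finrank_mulImage_add_finrank_annIn (φ c * φ c) K
    have h2 : mulImage (φ c * φ c) K ≤ V :=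
      mulImage_le fun x hx => by rw [mul_assoc]; exact hKV x hx _ _
    have h3 := Submodule.finrank_mono h2
    have h4 : annIn (φ c * φ c) K ≠ ⊥ := by
      intro hbot
      rw [hbot, finrank_bot] at h1
      omega
    obtain ⟨x, hx, hx0⟩ := Submodule.exists_mem_ne_zero_of_ne_bot h4
    rw [mem_annIn, mul_assoc] at hx
    exact ⟨x, hx.1, hx0, hx.2⟩
  have hy0 : φ c * x ≠ 0 := fun h0 => hx0 <| by
    have : x ∈ annIn (φ c) K := mem_annIn.mpr ⟨hxK, h0⟩
    rwa [hcK, Submodule.mem_bot] at this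
  have hyV : ∀ c', φ c' * (φ c * x) ∈ annIn (φ c) V := fun c' =>
    mem_annIn.mpr ⟨hKV x hxK _ _, by linear_combination φ c' * hccx⟩
  obtain ⟨c₁, hc₁⟩ : ∃ c₁, φ c₁ * (φ c * x) ≠ 0 := by
    by_contra! h0
    exact hy0 (h 2 (by norm_num) _ (mul_mem_range_pow_succ (hK hxK) _) h0)
  have hq := mem_annIn.mp (hyV c₁)
  have hmult : ∀ c', ∃ t : k, t • (φ c₁ * (φ c * x)) = φ c' * (φ c * x) := by
    intro c'
    obtain ⟨t, ht⟩ := (finrank_le_one_iff.mp hcV).imp fun v hv => hv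
    obtain ⟨t₁, ht₁⟩ := ht ⟨_, hyV c₁⟩
    obtain ⟨t₂, ht₂⟩ := ht ⟨_, hyV c'⟩
    have e₁ : t₁ • (t : A) = φ c₁ * (φ c * x) := congrArg Subtype.val ht₁
    have e₂ : t₂ • (t : A) = φ c' * (φ c * x) := congrArg Subtype.val ht₂
    have ht₁0 : t₁ ≠ 0 := by
      rintro rfl
      exact hc₁ (by rw [← e₁, zero_smul])
    refine ⟨t₂ * t₁⁻¹, ?_⟩
    rw [← e₁, ← e₂, smul_smul, mul_assoc, inv_mul_cancel₀ ht₁0, mul_one]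
  have hprop : ∀ c', ∃ t : k,
      φ c' * (φ c₁ * (φ c * x)) = t • (φ c₁ * (φ c₁ * (φ c * x))) := by
    intro c'
    obtain ⟨t, ht⟩ := hmult c'
    exact ⟨t, by rw [mul_left_comm, ← ht, mul_smul_comm]⟩
  refine ⟨_, hq.1, hc₁, φ c₁ * (φ c₁ * (φ c * x)), mul_mem_range_pow_succ (hV hq.1) _, ?_, ?_,
    hprop⟩
  · intro h0
    refine hc₁ (h 3 (by norm_num) _ (hV hq.1) fun c' => ?_)
    obtain ⟨t, ht⟩ := hprop c'
    rw [ht, h0, smul_zero]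
  · rw [mul_left_comm, hq.2, mul_zero]

variable [Infinite k]

theorem finrank_eq_four_and_exists_line (h : SocleFreeBelow_s14 φ 5)
    (hK : K ≤ LinearMap.range φ ^ 1) (hV : V ≤ LinearMap.range φ ^ 3)
    (hKV : ∀ x ∈ K, ∀ c c', φ c' * (φ c * x) ∈ V)
    (hlt : Module.finrank k V < Module.finrank k K) (hK4 : Module.finrank k K ≤ 4) :
    Module.finrank k K = 4 ∧
      ∃ L : Submodule k A, Module.finrank k L ≤ 2 ∧ ∀ y ∈ V, ∀ c, φ c * y ∈ L := by
  have hne := annIn_ne_bot_of_finrank_lt h hK hKV hlt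
  have hV3 : 3 ≤ Module.finrank k V := by
    by_contra! hV2
    obtain ⟨c, hc⟩ := (eventually_annIn_eq_bot h (d := 2) (by norm_num) hV (by omega)).exists
    exact hne c hc
  refine ⟨by omega, ?_⟩
  have hrank : ∀ᶠ c in zariskiGeneric k n, ∃ q ∈ V, q ≠ 0 ∧ ∃ u ∈ LinearMap.range φ ^ 4,
      u ≠ 0 ∧ φ c * u = 0 ∧ ∀ c', ∃ t : k, φ c' * q = t • u := by
    filter_upwards [eventually_annIn_eq_bot h (d := 4) (by norm_num) hK hK4,
      eventually_finrank_annIn_le_of_finrank_le_add h (d := 2) (s := 1) (by norm_num) hV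
        (by omega)] with c hcK hcV
    exact exists_rank_one_of_finrank_lt h hK hV hKV hlt hcK hcV
  obtain ⟨c₁, q₁, hq₁V, hq₁, u₁, hu₁U, hu₁, -, hqu₁⟩ := hrank.exists
  obtain ⟨c₂, hc₂, q₂, hq₂V, hq₂, u₂, hu₂U, hu₂, hcu₂, hqu₂⟩ :=
    ((eventually_mul_ne_zero h (by norm_num) hu₁U hu₁).and hrank).exists
  have hind : LinearIndependent k ![u₂, u₁] := by
    rw [LinearIndependent.pair_iff' hu₂]
    rintro t rfl
    exact hc₂ (by rw [mul_smul_comm, hcu₂, smul_zero])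
  set L := Submodule.span k (Set.range ![u₂, u₁])
  have hL : Module.finrank k L = 2 := (finrank_span_eq_card hind).trans (by simp)
  refine ⟨L, hL.le, fun y hy => forall_mem_of_eventually_mem (LinearMap.mulRight k y ∘ₗ φ) L ?_⟩
  filter_upwards [eventually_mul_ne_zero h (by norm_num) (hV hq₁V) hq₁,
    eventually_mul_ne_zero h (by norm_num) (hV hq₂V) hq₂] with c h₁ h₂
  have hmem : ∀ {q u : A}, q ∈ V → φ c * q ≠ 0 → (∀ c', ∃ t : k, φ c' * q = t • u) →
      u ∈ mulImage (φ c) V := by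
    intro q u hq h0 hqu
    obtain ⟨t, ht⟩ := hqu c
    have ht0 : t ≠ 0 := by
      rintro rfl
      exact h0 (by rw [ht, zero_smul])
    rw [← inv_smul_smul₀ ht0 u, ← ht]
    exact Submodule.smul_mem _ _ (mul_mem_mulImage hq)
  have hle : L ≤ mulImage (φ c) V := by
    refine Submodule.span_le.mpr ?_
    rintro _ ⟨i, rfl⟩
    fin_cases i
    · exact hmem hq₂V h₂ hqu₂
    · exact hmem hq₁V h₁ hqu₁
  have hrk := finrank_mulImage_add_finrank_annIn (φ c) V
  have hpos : Module.finrank k (annIn (φ c) V) ≠ 0 := fun h0 =>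
    hne c (Submodule.finrank_eq_zero.mp h0)
  rw [Submodule.eq_of_le_of_finrank_le hle (by omega)]
  exact mul_mem_mulImage hy

end SecondDerivatives

section Duality

variable {k A : Type*} [Field k] [CommRing A] [Algebra k A] {n : ℕ}
  {φ : (Fin n → k) →ₗ[k] A} {e : ℕ}

theorem eq_zero_of_forall_mul_eq_zero (h : SocleFreeBelow_s14 φ e) {j : ℕ} :
    ∀ {i : ℕ} {x : A}, i + j = e → x ∈ LinearMap.range φ ^ i →
      (∀ y ∈ LinearMap.range φ ^ j, x * y = 0) → x = 0 := by
  induction j with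
  | zero =>
    intro i x _ _ hxy
    simpa using hxy 1 (by rw [pow_zero]; exact Submodule.one_le.mp le_rfl)
  | succ j ih =>
    intro i x hij hx hxy
    refine h i (by omega) x hx fun c => ?_
    refine ih (i := i + 1) (by omega) (mul_mem_range_pow_succ hx c) fun y hy => ?_
    rw [mul_comm (φ c) x, mul_assoc]
    exact hxy _ (mul_mem_range_pow_succ hy c)

variable [FiniteDimensional k A]

theorem finrank_add_finrank_le_of_mul_eq_zero (h : SocleFreeBelow_s14 φ e)
    (he : Module.finrank k ↥(LinearMap.range φ ^ e) = 1) {i j : ℕ} (hij : i + j = e)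
    {Z T : Submodule k A} (hZ : Z ≤ LinearMap.range φ ^ i) (hT : T ≤ LinearMap.range φ ^ j)
    (hZT : ∀ z ∈ Z, ∀ t ∈ T, z * t = 0) :
    Module.finrank k Z + Module.finrank k T ≤ Module.finrank k ↥(LinearMap.range φ ^ j) := by
  set P := LinearMap.range φ ^ j with hP
  obtain ⟨ε, hε⟩ : ∃ ε : A →ₗ[k] k, ∀ x ∈ LinearMap.range φ ^ e, ε x = 0 → x = 0 := by
    obtain ⟨g, hg⟩ := (LinearMap.range φ ^ e).subtype.exists_leftInverse_of_injective
      (Submodule.ker_subtype _)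
    let f : ↥(LinearMap.range φ ^ e) ≃ₗ[k] k :=
      LinearEquiv.ofFinrankEq _ _ (by rw [he, Module.finrank_self])
    refine ⟨f.toLinearMap ∘ₗ g, fun x hx h0 => ?_⟩
    have h1 : g x = ⟨x, hx⟩ := LinearMap.congr_fun hg ⟨x, hx⟩
    have h2 : g x = 0 := by simpa using h0
    rw [h1] at h2
    exact congrArg Subtype.val h2
  let Ψ : Z →ₗ[k] Module.Dual k P := ((LinearMap.mul k A).compr₂ ε).domRestrict₁₂ Z P
  have hΨ : ∀ z w, Ψ z w = ε (z * w) := fun z w => rfl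
  have hinj : Function.Injective Ψ := by
    rw [injective_iff_map_eq_zero]
    intro z hz
    refine Subtype.ext (eq_zero_of_forall_mul_eq_zero h hij (hZ z.2) fun y hy => hε _ ?_ ?_)
    · rw [← hij, pow_add]
      exact Submodule.mul_mem_mul (hZ z.2) hy
    · rw [← hΨ z ⟨y, hy⟩, hz, LinearMap.zero_apply]
  have hrange : LinearMap.range Ψ ≤ (T.comap P.subtype).dualAnnihilator := by
    rintro _ ⟨z, rfl⟩
    rw [Submodule.mem_dualAnnihilator]
    intro w hw
    rw [hΨ, hZT z z.2 w hw, map_zero]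
  have h1 := Submodule.finrank_mono hrange
  rw [LinearMap.finrank_range_of_inj hinj] at h1
  have h2 := Subspace.finrank_add_finrank_dualAnnihilator_eq (T.comap P.subtype)
  have h3 := (Submodule.comapSubtypeEquivOfLe hT).finrank_eq
  omega

theorem finrank_range_pow_le (h : SocleFreeBelow_s14 φ e)
    (he : Module.finrank k ↥(LinearMap.range φ ^ e) = 1) {i j : ℕ} (hij : i + j = e) :
    Module.finrank k ↥(LinearMap.range φ ^ i) ≤ Module.finrank k ↥(LinearMap.range φ ^ j) := by
  simpa using finrank_add_finrank_le_of_mul_eq_zero h he hij le_rfl bot_le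
    (fun z _ t ht => by rw [(Submodule.mem_bot k).mp ht, mul_zero])

end Duality

section SocleDegreeFive

variable {k A : Type*} [Field k] [CommRing A] [Algebra k A] {n : ℕ}
  {φ : (Fin n → k) →ₗ[k] A} [Infinite k] [FiniteDimensional k A]

theorem finrank_annIn_eq_four_of_finrank_sq_lt (h : SocleFreeBelow_s14 φ 5)
    (h5 : Module.finrank k ↥(LinearMap.range φ ^ 5) = 1)
    (hlt : Module.finrank k ↥(LinearMap.range φ ^ 2) < Module.finrank k ↥(LinearMap.range φ ^ 1))
    {c : Fin n → k} (hc : Module.finrank k (annIn (φ c) (LinearMap.range φ ^ 1)) ≤ 4) :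
    Module.finrank k (annIn (φ c) (LinearMap.range φ ^ 1)) = 4 ∧
      Module.finrank k
        (annIn (φ c) (LinearMap.range φ ^ 1) * LinearMap.range φ ^ 3 : Submodule k A) ≤ 2 := by
  set U := LinearMap.range φ
  set K := annIn (φ c) (U ^ 1)
  have hK : K ≤ U ^ 1 := inf_le_left
  have hV : K * U ^ 2 ≤ annIn (φ c) (U ^ 3) := by
    refine Submodule.mul_le.mpr fun x hx y hy => mem_annIn.mpr ⟨?_, ?_⟩
    · exact pow_add U 1 2 ▸ Submodule.mul_mem_mul (hK hx) hy
    · rw [← mul_assoc, (mem_annIn.mp hx).2, zero_mul]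
  have hdual := finrank_add_finrank_le_of_mul_eq_zero h h5 (i := 3) (j := 2) (by norm_num)
    (Z := annIn (φ c) (U ^ 3)) (T := mulImage (φ c) (U ^ 1)) inf_le_left
    (mulImage_le_range_pow_succ le_rfl c) (by
      intro z hz t ht
      obtain ⟨x, -, rfl⟩ := mem_mulImage.mp ht
      rw [← mul_assoc, mul_comm z, (mem_annIn.mp hz).2, zero_mul])
  change _ ≤ Module.finrank k ↥(U ^ 2) at hdual
  have hrk := finrank_mulImage_add_finrank_annIn (φ c) (U ^ 1)
  change _ + Module.finrank k K = _ at hrk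
  have hVle := Submodule.finrank_mono hV
  obtain ⟨hK4, L, hL, hVL⟩ := finrank_eq_four_and_exists_line h hK
    (hV.trans inf_le_left) (fun x hx c₁ c₂ => by
      rw [← mul_assoc, mul_comm _ x]
      refine Submodule.mul_mem_mul hx ?_
      rw [pow_two]
      exact Submodule.mul_mem_mul ⟨c₂, rfl⟩ ⟨c₁, rfl⟩) (by omega) hc
  refine ⟨hK4, le_trans (Submodule.finrank_mono ?_) hL⟩
  rw [pow_succ U 2, ← mul_assoc]
  refine Submodule.mul_le.mpr ?_
  rintro y hy _ ⟨d, rfl⟩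
  rw [mul_comm]
  exact hVL y hy d

/-- One step of building a large sum of annihilators of general linear forms: `p` is the product of
the linear forms used so far, and `S` is the sum of their annihilators. -/
theorem exists_annihilator_sum_extension (h : SocleFreeBelow_s14 φ 5)
    (hgood : ∀ᶠ c in zariskiGeneric k n,
      Module.finrank k (annIn (φ c) (LinearMap.range φ ^ 1)) = 4 ∧
        Module.finrank k
        (annIn (φ c) (LinearMap.range φ ^ 1) * LinearMap.range φ ^ 3 : Submodule k A) ≤ 2)
    {c₀ : Fin n → k} (hc₀ : Module.finrank k (annIn (φ c₀) (LinearMap.range φ ^ 1)) = 4)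
    {d t σ τ j : ℕ} (hj : j + d = 5) (hdt : d ≤ t) :
    (∃ (p : A) (S : Submodule k A), mulImage p (annIn (φ c₀) (LinearMap.range φ ^ 1)) ≤
        LinearMap.range φ ^ j ∧ S ≤ annIn p (LinearMap.range φ ^ 1) ∧
      t ≤ Module.finrank k (mulImage p (annIn (φ c₀) (LinearMap.range φ ^ 1))) ∧
      σ ≤ Module.finrank k S ∧ Module.finrank k (S * LinearMap.range φ ^ 3 : Submodule k A) ≤ τ) →
    ∃ (p : A) (S : Submodule k A), mulImage p (annIn (φ c₀) (LinearMap.range φ ^ 1)) ≤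
        LinearMap.range φ ^ (j + 1) ∧ S ≤ annIn p (LinearMap.range φ ^ 1) ∧
      d ≤ Module.finrank k (mulImage p (annIn (φ c₀) (LinearMap.range φ ^ 1))) ∧
      σ + t ≤ Module.finrank k S ∧ Module.finrank k (S * LinearMap.range φ ^ 3 : Submodule k A) ≤ τ + 2 := by
  set U := LinearMap.range φ
  set K₀ := annIn (φ c₀) (U ^ 1)
  rintro ⟨p, S, hpK, hS, ht, hσ, hτ⟩
  obtain ⟨c, ⟨hc4, hc2⟩, hd, hann⟩ := (hgood.and ((eventually_le_finrank_mulImage h hj hpK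
    (hdt.trans ht)).and (eventually_finrank_annIn_le φ (annIn p (U ^ 1)) c₀))).exists
  set K := annIn (φ c) (U ^ 1)
  have himage : mulImage (φ c * p) K₀ = mulImage (φ c) (mulImage p K₀) := by
    ext y
    simp [mem_mulImage, mul_assoc]
  refine ⟨φ c * p, S ⊔ K, ?_, ?_, ?_, ?_, ?_⟩
  · rw [himage]
    exact mulImage_le_range_pow_succ hpK c
  · refine sup_le (fun x hx => ?_) fun x hx => ?_
    · obtain ⟨h1, h2⟩ := mem_annIn.mp (hS hx)
      exact mem_annIn.mpr ⟨h1, by rw [mul_assoc, h2, mul_zero]⟩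
    · obtain ⟨h1, h2⟩ := mem_annIn.mp hx
      exact mem_annIn.mpr ⟨h1, by rw [mul_right_comm, h2, zero_mul]⟩
  · rwa [himage]
  · have hcomm : annIn (φ c₀) (annIn p (U ^ 1)) = annIn p K₀ := by
      ext x
      simp only [K₀, mem_annIn]
      tauto
    have h1 := finrank_mulImage_add_finrank_annIn p K₀
    rw [hcomm] at hann
    have h2 := Submodule.finrank_sup_add_finrank_inf_eq S K
    have h3 : S ⊓ K ≤ annIn (φ c) (annIn p (U ^ 1)) := fun x hx =>
      mem_annIn.mpr ⟨hS hx.1, (mem_annIn.mp hx.2).2⟩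
    have h4 := Submodule.finrank_mono h3
    omega
  · rw [Submodule.sup_mul]
    exact (Submodule.finrank_add_le_finrank_add_finrank _ _).trans (add_le_add hτ hc2)

theorem finrank_le_finrank_sq_of_socleFreeBelow_five (h : SocleFreeBelow_s14 φ 5)
    (h5 : Module.finrank k ↥(LinearMap.range φ ^ 5) = 1)
    (h14 : Module.finrank k ↥(LinearMap.range φ ^ 1) ≤ 14) :
    Module.finrank k ↥(LinearMap.range φ ^ 1) ≤ Module.finrank k ↥(LinearMap.range φ ^ 2) := by
  by_contra! hlt
  have hgood : ∀ᶠ c in zariskiGeneric k n,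
      Module.finrank k (annIn (φ c) (LinearMap.range φ ^ 1)) = 4 ∧
        Module.finrank k
        (annIn (φ c) (LinearMap.range φ ^ 1) * LinearMap.range φ ^ 3 : Submodule k A) ≤ 2 := by
    filter_upwards [eventually_finrank_annIn_le_of_lt_choose h (d := 4) (j := 1) (by norm_num)
      le_rfl (by omega)] with c hc
    exact finrank_annIn_eq_four_of_finrank_sq_lt h h5 hlt hc
  obtain ⟨c₀, hc₀, -⟩ := hgood.exists
  obtain ⟨p, S, -, hS, -, hσ, hτ⟩ :=
    exists_annihilator_sum_extension h hgood hc₀ (j := 5) (d := 0) (t := 1) (σ := 13) (τ := 8)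
      (by norm_num) (by norm_num) <|
    exists_annihilator_sum_extension h hgood hc₀ (j := 4) (d := 1) (t := 2) (σ := 11) (τ := 6)
      (by norm_num) (by norm_num) <|
    exists_annihilator_sum_extension h hgood hc₀ (j := 3) (d := 2) (t := 3) (σ := 8) (τ := 4)
      (by norm_num) (by norm_num) <|
    exists_annihilator_sum_extension h hgood hc₀ (j := 2) (d := 3) (t := 4) (σ := 4) (τ := 2)
      (by norm_num) (by norm_num) <|
    exists_annihilator_sum_extension h hgood hc₀ (j := 1) (d := 4) (t := 4) (σ := 0) (τ := 0)
      (by norm_num) (by norm_num) <| by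
      have h1 : mulImage 1 (annIn (φ c₀) (LinearMap.range φ ^ 1)) =
          annIn (φ c₀) (LinearMap.range φ ^ 1) := by
        ext x
        simp [mem_mulImage]
      refine ⟨1, ⊥, ?_, bot_le, ?_, Nat.zero_le _, by simp⟩
      · rw [h1]
        exact inf_le_left
      · rw [h1, hc₀]
  have hSU : S = LinearMap.range φ ^ 1 :=
    Submodule.eq_of_le_of_finrank_le (hS.trans inf_le_left) (by omega)
  rw [hSU, show LinearMap.range φ ^ 1 * LinearMap.range φ ^ 3 = LinearMap.range φ ^ 4 from
    (pow_add _ 1 3).symm] at hτ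
  rw [hSU] at hσ
  have := finrank_range_pow_le h h5 (i := 1) (j := 4) (by norm_num)
  omega

end SocleDegreeFive

section PresentedAlgebra

/-- The linear map sending a coefficient vector to the class of its linear form in `R/I`. -/
noncomputable def linFormClass (k : Type*) [Field k] (r : ℕ)
    (I : Ideal (MvPolynomial (Fin r) k)) :
    (Fin r → k) →ₗ[k] MvPolynomial (Fin r) k ⧸ I :=
  (Ideal.Quotient.mkₐ k I).toLinearMap ∘ₗ Fintype.linearCombination k X

variable {k : Type*} [Field k] {r : ℕ} {I : Ideal (MvPolynomial (Fin r) k)}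

theorem linFormClass_single (i : Fin r) :
    linFormClass k r I (Pi.single i 1) = Ideal.Quotient.mk I (X i) := by
  simp [linFormClass, Fintype.linearCombination_apply_single]

theorem gradedPiece_eq_range_pow (d : ℕ) :
    gradedPiece k r I d = LinearMap.range (linFormClass k r I) ^ d := by
  rw [gradedPiece, ← homogeneousSubmodule_one_pow, Submodule.map_pow, linFormClass,
    LinearMap.range_comp, Fintype.range_linearCombination, homogeneousSubmodule_one_eq_span_X]

theorem socleFreeBelow_linFormClass [Module.Finite k (MvPolynomial (Fin r) k ⧸ I)] {e : ℕ}
    (h : ∀ i < e, socDim k r I i = 0) : SocleFreeBelow_s14 (linFormClass k r I) e := by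
  intro j hj x hx hxφ
  rw [← gradedPiece_eq_range_pow] at hx
  obtain ⟨f, hf, rfl⟩ := hx
  have hbot := Submodule.finrank_eq_zero.mp (h j hj)
  rw [← Submodule.mem_bot k, ← hbot]
  refine Submodule.mem_map_of_mem ⟨hf, ?_⟩
  simp only [SetLike.mem_coe, Submodule.mem_iInf, Submodule.mem_comap, LinearMap.mulLeft_apply,
    Submodule.restrictScalars_mem]
  intro i
  rw [← Ideal.Quotient.eq_zero_iff_mem, map_mul, ← linFormClass_single]
  exact hxφ _

theorem socDim_eq_hilb [Module.Finite k (MvPolynomial (Fin r) k ⧸ I)] {e : ℕ}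
    (h : hilb k r I (e + 1) = 0) : socDim k r I e = hilb k r I e := by
  have hbot := Submodule.finrank_eq_zero.mp h
  rw [socDim, hilb, gradedPiece, inf_eq_left.mpr]
  intro f hf
  simp only [Submodule.mem_iInf, Submodule.mem_comap, LinearMap.mulLeft_apply,
    Submodule.restrictScalars_mem]
  intro i
  rw [← Ideal.Quotient.eq_zero_iff_mem, ← Submodule.mem_bot k, ← hbot]
  refine Submodule.mem_map_of_mem (f := (Ideal.Quotient.mkₐ k I).toLinearMap) ?_
  rw [add_comm]
  exact (isHomogeneous_X k i).mul hf

end PresentedAlgebra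

/-- Remark 3.10: in characteristic zero, every Hilbert function of a standard
graded artinian Gorenstein algebra of socle degree `5` and codimension
`r ≤ 14` is unimodal. -/
theorem gorenstein_socdeg5_codim_le_14_unimodal
    (k : Type*) [Field k] [Infinite k] [CharZero k]
    (r : ℕ)
    (I : Ideal (MvPolynomial (Fin r) k))
    (hlin : NoLinearForms I) (hGor : Gorenstein k r 5 I)
    (hcodim : hilb k r I 1 ≤ 14) :
    ∃ j : ℕ, j ≤ 5 ∧
      (∀ i : ℕ, i < j → hilb k r I i ≤ hilb k r I (i + 1)) ∧
      (∀ i : ℕ, j ≤ i → i < 5 → hilb k r I (i + 1) ≤ hilb k r I i) := by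
  obtain ⟨⟨-, hfin⟩, ⟨-, hvanish⟩, hsoc, hsoc5⟩ := hGor
  have hsf := socleFreeBelow_linFormClass hsoc
  have h5 : hilb k r I 5 = 1 := (socDim_eq_hilb (hvanish 6 (by norm_num))).symm.trans hsoc5
  have hpow (d : ℕ) :
      hilb k r I d = Module.finrank k ↥(LinearMap.range (linFormClass k r I) ^ d) := by
    rw [hilb, gradedPiece_eq_range_pow]
  have hle {i j : ℕ} (hij : i + j = 5) : hilb k r I i ≤ hilb k r I j := by
    rw [hpow, hpow]
    exact finrank_range_pow_le hsf (by rw [← hpow, h5]) hij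
  have h12 : hilb k r I 1 ≤ hilb k r I 2 := by
    rw [hpow, hpow]
    exact finrank_le_finrank_sq_of_socleFreeBelow_five hsf (by rw [← hpow, h5])
      (by rwa [← hpow])
  have h1 : hilb k r I 1 ≠ 0 := by
    intro h0
    rw [hpow, Submodule.finrank_eq_zero, Submodule.pow_one] at h0
    rw [hpow, h0, Submodule.pow_succ, Submodule.mul_bot, finrank_bot] at h5
    exact zero_ne_one h5
  have h05 := hle (i := 0) (j := 5) rfl
  have h32 := hle (i := 3) (j := 2) rfl
  have h41 := hle (i := 4) (j := 1) rfl
  have h23 := hle (i := 2) (j := 3) rfl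
  have h14 := hle (i := 1) (j := 4) rfl
  refine ⟨2, by norm_num, fun i hi => ?_, fun i hi hi5 => ?_⟩ <;> interval_cases i <;>
    simp only [Nat.reduceAdd] <;> omega
end
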